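/- arXiv:math/9707212 — 2 statements merged into one kernel-verified Lean document; each statement's English description precedes it below -/
import Mathlib

section
/- Let Ψ = {(t,t') ∈ ℝ² : t ≤ t'} be the closed half-plane and let T ⊂ B(Ψ,3) be the set of all configurations of the form {(x,y), (x,z), (y,z)} with x < y < z. Then the reduced singular homology with ℤ coefficients of the one-point compactification of B(Ψ,3) ∖ T is isomorphic to ℤ in degree 4 and vanishes in every other degree. -/
/-!
Statement 12: Let T ⊂ B(Ψ,3) be the set of configurations
{(x,y), (x,z), (y,z)} with x < y < z.  The reduced homology of
(B(Ψ,3) ∖ T)⁺ is ℤ in degree 4 and vanishes in every other degree.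
-/

set_option autoImplicit false

noncomputable section

open Finset

/-! ### Reduced singular homology -/

/-- The standard topological `i`-simplex. -/
abbrev Spx (i : ℕ) : Type := (stdSimplex ℝ (Fin (i + 1)) : Set (Fin (i + 1) → ℝ))

/-- The value of the `j`-th face embedding `Δ^i → Δ^{i+1}`. -/
def faceVal (i : ℕ) (j : Fin (i + 2)) (x : Spx i) : Fin (i + 2) → ℝ :=
  fun l => ∑ m ∈ Finset.univ.filter (fun m : Fin (i + 1) => j.succAbove m = l), x.1 m

lemma faceVal_mem (i : ℕ) (j : Fin (i + 2)) (x : Spx i) :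
    faceVal i j x ∈ stdSimplex ℝ (Fin (i + 2)) := by
  obtain ⟨h1, h2⟩ := x.2
  constructor
  · intro l
    exact Finset.sum_nonneg fun m _ => h1 m
  · rw [show ∑ l, faceVal i j x l =
      ∑ l, ∑ m ∈ Finset.univ.filter (fun m : Fin (i + 1) => j.succAbove m = l), x.1 m from rfl]
    rw [Finset.sum_fiberwise]
    exact h2

/-- The `j`-th face map `Δ^i → Δ^{i+1}` of standard simplices. -/
def faceMap (i : ℕ) (j : Fin (i + 2)) : C(Spx i, Spx (i + 1)) :=
  ⟨fun x => ⟨faceVal i j x, faceVal_mem i j x⟩, by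
    apply Continuous.subtype_mk
    apply continuous_pi
    intro l
    exact continuous_finset_sum _ fun m _ => (continuous_apply m).comp continuous_subtype_val⟩

variable (Y : Type) [TopologicalSpace Y]

/-- Singular `i`-simplices of `Y`. -/
abbrev Sing (i : ℕ) : Type := C(Spx i, Y)

/-- The augmented singular chain complex of `Y`: in degree `0` the group `ℤ`,
in degree `i + 1` the free abelian group on the singular `i`-simplices. -/
def RC : ℕ → Type
  | 0 => ℤ
  | (i + 1) => Sing Y i →₀ ℤ

instance : ∀ d, AddCommGroup (RC Y d)
  | 0 => inferInstanceAs (AddCommGroup ℤ)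
  | (i + 1) => inferInstanceAs (AddCommGroup (Sing Y i →₀ ℤ))

instance : ∀ d, Module ℤ (RC Y d)
  | 0 => inferInstanceAs (Module ℤ ℤ)
  | (i + 1) => inferInstanceAs (Module ℤ (Sing Y i →₀ ℤ))

/-- The boundary operators of the augmented singular chain complex: in lowest
degree the augmentation (the sum of the coefficients), in higher degrees the
alternating sum `∂σ = Σ_j (−1)^j (σ ∘ δ_j)` over the faces. -/
def rbdry : ∀ d : ℕ, RC Y (d + 1) →ₗ[ℤ] RC Y d
  | 0 => Finsupp.lift ℤ ℤ (Sing Y 0) fun _ => (1 : ℤ)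
  | (i + 1) => Finsupp.lift (RC Y (i + 1)) ℤ (Sing Y (i + 1)) fun σ =>
      ∑ j : Fin (i + 2), ((-1 : ℤ) ^ (j : ℕ)) •
        Finsupp.single (σ.comp (faceMap i j)) (1 : ℤ)

/-- The reduced singular homology of `Y` with integer coefficients, in
degree `i`: cycles (of the augmented complex) modulo boundaries. -/
abbrev RedHomology (i : ℕ) : Type :=
  LinearMap.ker (rbdry Y i) ⧸
    Submodule.comap (LinearMap.ker (rbdry Y i)).subtype (LinearMap.range (rbdry Y (i + 1)))

end

noncomputable section

/-! ### Unordered configuration spaces -/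

/-- Injective `k`-tuples in `X`, with the subspace topology. -/
abbrev InjTuple (X : Type) (k : ℕ) : Type := {f : Fin k → X // Function.Injective f}

/-- Two injective tuples are equivalent iff they differ by a permutation of
the indices, i.e. have the same image. -/
def configSetoid (X : Type) (k : ℕ) : Setoid (InjTuple X k) where
  r f g := ∃ σ : Equiv.Perm (Fin k), f.1 = g.1 ∘ σ
  iseqv := by
    constructor
    · exact fun f => ⟨1, by funext x; simp⟩
    · rintro f g ⟨σ, h⟩
      refine ⟨σ⁻¹, ?_⟩
      funext x
      rw [h]
      simp
    · rintro f g h ⟨σ, hfg⟩ ⟨τ, hgh⟩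
      refine ⟨τ * σ, ?_⟩
      funext x
      rw [hfg, hgh]
      simp

/-- The unordered configuration space `B(X, k)` of `k`-element subsets of `X`:
the quotient of the space of injective `k`-tuples by the permutation action,
with the quotient topology. -/
abbrev Config (X : Type) [TopologicalSpace X] (k : ℕ) : Type := Quotient (configSetoid X k)

/-- The closed half-plane `Ψ = {(t, t′) ∈ ℝ² : t ≤ t′}`. -/
abbrev Psi : Type := {p : ℝ × ℝ // p.1 ≤ p.2}

end

/-- The set `T ⊂ B(Ψ,3)` of all configurations of the form
`{(x,y), (x,z), (y,z)}` with `x < y < z`. -/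
def TriSet : Set (Config Psi 3) :=
  {c | ∃ (x y z : ℝ) (hxy : x < y) (hyz : y < z) (f : InjTuple Psi 3),
    c = Quotient.mk (configSetoid Psi 3) f ∧
    Set.range f.1 = {⟨(x, y), le_of_lt hxy⟩, ⟨(x, z), le_of_lt (hxy.trans hyz)⟩,
      ⟨(y, z), le_of_lt hyz⟩}}

/-! ### Functoriality of the augmented singular chain complex -/

noncomputable section

namespace RC

variable {Y Z W : Type} [TopologicalSpace Y] [TopologicalSpace Z] [TopologicalSpace W]
variable {M : Type} [AddCommGroup M] [Module ℤ M]

/-- The generator of the augmented complex in its lowest degree. -/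
def unit : RC Y 0 := (1 : ℤ)

/-- The chain of a single singular simplex. -/
def of {i : ℕ} (σ : Sing Y i) : RC Y (i + 1) := Finsupp.single σ (1 : ℤ)

/-- The linear map on chains with prescribed values on simplices. -/
def lift {i : ℕ} (φ : Sing Y i → M) : RC Y (i + 1) →ₗ[ℤ] M :=
  Finsupp.lift M ℤ (Sing Y i) φ

@[simp] lemma lift_of {i : ℕ} (φ : Sing Y i → M) (σ : Sing Y i) : lift φ (of σ) = φ σ :=
  congrFun ((Finsupp.lift M ℤ (Sing Y i)).symm_apply_apply φ) σ

lemma hom_ext {i : ℕ} {f g : RC Y (i + 1) →ₗ[ℤ] M} (h : ∀ σ, f (of σ) = g (of σ)) : f = g :=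
  Finsupp.lhom_ext' (R := ℤ) (M := ℤ) (α := Sing Y i) fun σ => LinearMap.ext_ring (h σ)

lemma hom_ext_zero {f g : RC Y 0 →ₗ[ℤ] M} (h : f unit = g unit) : f = g :=
  LinearMap.ext_ring (R := ℤ) h

@[simp] lemma rbdry_zero_of (σ : Sing Y 0) : rbdry Y 0 (of σ) = unit :=
  lift_of (M := ℤ) _ σ

@[simp] lemma rbdry_succ_of {i : ℕ} (σ : Sing Y (i + 1)) :
    rbdry Y (i + 1) (of σ) =
      ∑ j : Fin (i + 2), ((-1 : ℤ) ^ (j : ℕ)) • of (σ.comp (faceMap i j)) :=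
  lift_of (M := RC Y (i + 1)) _ σ

/-- The chain map induced by a continuous map. -/
def map (f : C(Y, Z)) : ∀ d, RC Y d →ₗ[ℤ] RC Z d
  | 0 => (LinearMap.id : ℤ →ₗ[ℤ] ℤ)
  | (_ + 1) => lift fun σ => of (f.comp σ)

@[simp] lemma map_unit (f : C(Y, Z)) : map f 0 unit = unit := rfl

@[simp] lemma map_of {i : ℕ} (f : C(Y, Z)) (σ : Sing Y i) :
    map f (i + 1) (of σ) = of (f.comp σ) := lift_of _ σ

lemma map_map (g : C(Z, W)) (f : C(Y, Z)) (d : ℕ) (c : RC Y d) :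
    map g d (map f d c) = map (g.comp f) d c := by
  cases d with
  | zero => rfl
  | succ i =>
    refine LinearMap.congr_fun (f := (map g (i + 1)).comp (map f (i + 1))) (hom_ext fun σ => ?_) c
    simp [ContinuousMap.comp_assoc]

lemma map_id (d : ℕ) (c : RC Y d) : map (ContinuousMap.id Y) d c = c := by
  cases d with
  | zero => rfl
  | succ i =>
    refine LinearMap.congr_fun (g := LinearMap.id) (hom_ext fun σ => ?_) c
    simp

lemma rbdry_map (f : C(Y, Z)) (d : ℕ) (c : RC Y (d + 1)) :
    rbdry Z d (map f (d + 1) c) = map f d (rbdry Y d c) := by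
  refine LinearMap.congr_fun (f := (rbdry Z d).comp (map f (d + 1)))
    (g := (map f d).comp (rbdry Y d)) (hom_ext fun σ => ?_) c
  cases d with
  | zero => simp
  | succ i => simp [map_sum, ContinuousMap.comp_assoc]

end RC

/-! ### Face maps -/

@[simp] lemma faceMap_succAbove (i : ℕ) (j : Fin (i + 2)) (x : Spx i) (m : Fin (i + 1)) :
    (faceMap i j x).1 (j.succAbove m) = x.1 m := by
  change ∑ m' ∈ Finset.univ.filter (fun m' : Fin (i + 1) => j.succAbove m' = j.succAbove m),
    x.1 m' = x.1 m
  simp [Finset.filter_eq']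

@[simp] lemma faceMap_self (i : ℕ) (j : Fin (i + 2)) (x : Spx i) : (faceMap i j x).1 j = 0 := by
  change ∑ m' ∈ Finset.univ.filter (fun m' : Fin (i + 1) => j.succAbove m' = j), x.1 m' = 0
  simp [Fin.succAbove_ne]

/-- The point `(τ, (1 - τ) s)` of `Δ^{i+1}`, on the segment from `(0, s)` to the vertex `0`. -/
def joinMap (i : ℕ) : C(Spx i × unitInterval, Spx (i + 1)) where
  toFun p := ⟨Fin.cons (p.2 : ℝ) fun m => (1 - p.2) * p.1.1 m, by
    constructor
    · intro l
      refine Fin.cases ?_ (fun m => ?_) l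
      · exact p.2.2.1
      · exact mul_nonneg (sub_nonneg.2 p.2.2.2) (p.1.2.1 m)
    · rw [Fin.sum_univ_succ]
      simp [← Finset.mul_sum, p.1.2.2]⟩
  continuous_toFun := by
    refine Continuous.subtype_mk (continuous_pi fun l => ?_) _
    refine Fin.cases ?_ (fun m => ?_) l
    · simp only [Fin.cons_zero]; fun_prop
    · simp only [Fin.cons_succ]
      exact (continuous_const.sub (continuous_subtype_val.comp continuous_snd)).mul
        ((continuous_apply m).comp (continuous_subtype_val.comp continuous_fst))

@[simp] lemma joinMap_zero (i : ℕ) (s : Spx i) (τ : unitInterval) :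
    (joinMap i (s, τ)).1 0 = τ := rfl

@[simp] lemma joinMap_succ (i : ℕ) (s : Spx i) (τ : unitInterval) (m : Fin (i + 1)) :
    (joinMap i (s, τ)).1 m.succ = (1 - τ) * s.1 m := rfl

lemma joinMap_surjective (i : ℕ) : Function.Surjective (joinMap i) := by
  intro x
  have hsum : x.1 0 + ∑ m : Fin (i + 1), x.1 m.succ = 1 := by
    rw [← Fin.sum_univ_succ]; exact x.2.2
  have h0 := x.2.1 0
  have hle : x.1 0 ≤ 1 := by
    have := Finset.sum_nonneg fun (m : Fin (i + 1)) (_ : m ∈ Finset.univ) => x.2.1 m.succ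
    linarith
  by_cases h1 : x.1 0 = 1
  · refine ⟨(⟨Pi.single 0 1, single_mem_stdSimplex ℝ 0⟩, ⟨1, by simp⟩),
      Subtype.ext (funext fun l => ?_)⟩
    refine Fin.cases ?_ (fun m => ?_) l
    · simp [h1]
    · have hs : ∑ m : Fin (i + 1), x.1 m.succ = 0 := by linarith
      have := (Finset.sum_eq_zero_iff_of_nonneg fun m _ => x.2.1 (Fin.succ m)).1 hs m
        (Finset.mem_univ m)
      simp [this]
  · have hpos : 0 < 1 - x.1 0 := sub_pos.2 (lt_of_le_of_ne hle h1)
    refine ⟨(⟨fun m => x.1 m.succ / (1 - x.1 0), ?_, ?_⟩, ⟨x.1 0, h0, hle⟩),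
      Subtype.ext (funext fun l => ?_)⟩
    · exact fun m => div_nonneg (x.2.1 _) hpos.le
    · rw [← Finset.sum_div, div_eq_one_iff_eq hpos.ne']; linarith
    · refine Fin.cases ?_ (fun m => ?_) l
      · simp
      · simp only [joinMap_succ]; field_simp

lemma isQuotientMap_joinMap (i : ℕ) : Topology.IsQuotientMap (joinMap i) :=
  ((joinMap i).continuous.isClosedMap).isQuotientMap (joinMap i).continuous (joinMap_surjective i)

lemma faceMap_zero_eq_joinMap (i : ℕ) (s : Spx i) : faceMap i 0 s = joinMap i (s, 0) := by
  refine Subtype.ext (funext fun l => ?_)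
  refine Fin.cases ?_ (fun m => ?_) l
  · simp
  · rw [← Fin.succAbove_zero, faceMap_succAbove]; simp

lemma faceMap_succ_joinMap (i : ℕ) (j : Fin (i + 2)) (s : Spx i) (τ : unitInterval) :
    faceMap (i + 1) j.succ (joinMap i (s, τ)) = joinMap (i + 1) (faceMap i j s, τ) := by
  refine Subtype.ext (funext fun l => ?_)
  rcases Fin.eq_self_or_eq_succAbove j.succ l with rfl | ⟨m, rfl⟩
  · simp
  · rw [faceMap_succAbove]
    refine Fin.cases ?_ (fun m => ?_) m
    · simp
    · simp

lemma faceMap_one_joinMap (s : Spx 0) (x : Spx 0) : faceMap 0 1 x = joinMap 0 (s, 1) := by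
  have hx : x.1 0 = 1 := by simpa using x.2.2
  refine Subtype.ext (funext fun l => ?_)
  refine Fin.cases ?_ (fun m => ?_) l
  · have := faceMap_succAbove 0 1 x 0
    simpa [hx] using this
  · have := faceMap_self 0 1 x
    obtain rfl := Subsingleton.elim m 0
    refine this.trans ?_
    rw [joinMap_succ]
    simp

/-! ### Cones -/

/-- A homotopy from a map `f : Y → Z` to the constant map at `pt`. -/
structure NullHtpy {Y Z : Type} [TopologicalSpace Y] [TopologicalSpace Z] (f : C(Y, Z)) where
  /-- the homotopy -/
  hom : C(Y × unitInterval, Z)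
  /-- the final point -/
  pt : Z
  hom_zero : ∀ y, hom (y, 0) = f y
  hom_one : ∀ y, hom (y, 1) = pt

namespace NullHtpy

variable {Y Z W : Type} [TopologicalSpace Y] [TopologicalSpace Z] {f : C(Y, Z)} (h : NullHtpy f)

lemma exists_cone {i : ℕ} (σ : Sing Y i) :
    ∃ κ : Sing Z (i + 1), ∀ s τ, κ (joinMap i (s, τ)) = h.hom (σ s, τ) := by
  let g : Spx i × unitInterval → Z := fun p => h.hom (σ p.1, p.2)
  have hg : Continuous g := by fun_prop
  have hfac : ∀ p q, joinMap i p = joinMap i q → g p = g q := by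
    rintro ⟨s, τ⟩ ⟨s', τ'⟩ e
    have h0 : τ = τ' := Subtype.ext (by simpa using congrArg (fun x => x.1 0) e)
    subst h0
    by_cases h1 : τ = 1
    · subst h1
      simp only [g, h.hom_one]
    · have hs : s = s' := by
        refine Subtype.ext (funext fun m => ?_)
        have := congrArg (fun x => x.1 (Fin.succ m)) e
        have hne : (1 - (τ : ℝ)) ≠ 0 := fun h => h1 (Subtype.ext (sub_eq_zero.1 h).symm)
        simpa [hne] using this
      rw [hs]
  have hinv := Function.surjInv_eq (joinMap_surjective i)
  refine ⟨⟨fun x => g (Function.surjInv (joinMap_surjective i) x), ?_⟩, fun s τ => ?_⟩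
  · rw [(isQuotientMap_joinMap i).continuous_iff]
    exact hg.congr fun p => (hfac _ _ (hinv _)).symm
  · exact hfac _ _ (hinv _)

/-- The cone of a singular simplex. -/
def coneSimplex {i : ℕ} (σ : Sing Y i) : Sing Z (i + 1) := (h.exists_cone σ).choose

@[simp] lemma coneSimplex_joinMap {i : ℕ} (σ : Sing Y i) (s : Spx i) (τ : unitInterval) :
    h.coneSimplex σ (joinMap i (s, τ)) = h.hom (σ s, τ) := (h.exists_cone σ).choose_spec s τ

lemma coneSimplex_face_zero {i : ℕ} (σ : Sing Y i) :
    (h.coneSimplex σ).comp (faceMap i 0) = f.comp σ := by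
  ext s
  simp [faceMap_zero_eq_joinMap, h.hom_zero]

lemma coneSimplex_face_succ {i : ℕ} (σ : Sing Y (i + 1)) (j : Fin (i + 2)) :
    (h.coneSimplex σ).comp (faceMap (i + 1) j.succ) = h.coneSimplex (σ.comp (faceMap i j)) := by
  ext x
  obtain ⟨⟨s, τ⟩, rfl⟩ := joinMap_surjective i x
  simp [faceMap_succ_joinMap]

lemma coneSimplex_face_one (σ : Sing Y 0) :
    (h.coneSimplex σ).comp (faceMap 0 1) = ContinuousMap.const _ h.pt := by
  ext x
  simp [faceMap_one_joinMap x x, h.hom_one]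

/-- The cone operator on chains. -/
def cone : ∀ d, RC Y d →ₗ[ℤ] RC Z (d + 1)
  | 0 => LinearMap.toSpanSingleton ℤ (RC Z 1) (RC.of (ContinuousMap.const _ h.pt))
  | (_ + 1) => RC.lift fun σ => RC.of (h.coneSimplex σ)

lemma cone_zero_one : h.cone 0 RC.unit = RC.of (ContinuousMap.const _ h.pt) :=
  one_smul ℤ (RC.of (ContinuousMap.const _ h.pt) : RC Z 1)

@[simp] lemma cone_of {i : ℕ} (σ : Sing Y i) :
    h.cone (i + 1) (RC.of σ) = RC.of (h.coneSimplex σ) := RC.lift_of _ σ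

lemma rbdry_cone_zero (c : RC Y 0) : rbdry Z 0 (h.cone 0 c) = RC.map f 0 c := by
  refine LinearMap.congr_fun (f := (rbdry Z 0).comp (h.cone 0)) (RC.hom_ext_zero ?_) c
  rw [LinearMap.comp_apply, cone_zero_one]
  simp

lemma rbdry_cone (d : ℕ) (c : RC Y (d + 1)) :
    rbdry Z (d + 1) (h.cone (d + 1) c) = RC.map f (d + 1) c - h.cone d (rbdry Y d c) := by
  refine LinearMap.congr_fun (f := (rbdry Z (d + 1)).comp (h.cone (d + 1)))
    (g := RC.map f (d + 1) - (h.cone d).comp (rbdry Y d)) (RC.hom_ext fun σ => ?_) c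
  cases d with
  | zero =>
    simp only [LinearMap.comp_apply, cone_of, RC.rbdry_succ_of, LinearMap.sub_apply, RC.map_of,
      RC.rbdry_zero_of, cone_zero_one]
    rw [Fin.sum_univ_two, coneSimplex_face_zero, coneSimplex_face_one]
    simp [sub_eq_add_neg]
  | succ i =>
    simp only [LinearMap.comp_apply, cone_of, RC.rbdry_succ_of, LinearMap.sub_apply, RC.map_of]
    rw [Fin.sum_univ_succ, coneSimplex_face_zero]
    simp [coneSimplex_face_succ, pow_succ, map_sum, sub_eq_add_neg]

end NullHtpy

end

/-! ### Contractible spaces and the relation `∂ ∘ ∂ = 0` -/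

noncomputable section

namespace NullHtpy

/-- The straight-line contraction of a star-shaped set. -/
def ofStarConvex {E : Type} [AddCommGroup E] [Module ℝ E] [TopologicalSpace E] [ContinuousAdd E]
    [ContinuousSMul ℝ E] {S : Set E} {b : E} (hb : b ∈ S) (hS : StarConvex ℝ b S) :
    NullHtpy (ContinuousMap.id S) where
  hom := ⟨fun p => ⟨(p.2 : ℝ) • b + (1 - (p.2 : ℝ)) • (p.1 : E),
    hS p.1.2 p.2.2.1 (sub_nonneg.2 p.2.2.2) (by ring)⟩, by fun_prop⟩
  pt := ⟨b, hb⟩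
  hom_zero y := Subtype.ext (by simp)
  hom_one y := Subtype.ext (by simp)

/-- The straight-line contraction of a standard simplex to one of its points. -/
def spx {i : ℕ} (b : Spx i) : NullHtpy (ContinuousMap.id (Spx i)) :=
  ofStarConvex b.2 ((convex_stdSimplex ℝ (Fin (i + 1))).starConvex b.2)

lemma spx_hom {i : ℕ} (b x : Spx i) (τ : unitInterval) :
    ((spx b).hom (x, τ)).1 = (τ : ℝ) • b.1 + (1 - (τ : ℝ)) • x.1 := rfl

/-- The product of two contractions. -/
def prod {Y Z : Type} [TopologicalSpace Y] [TopologicalSpace Z]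
    (h : NullHtpy (ContinuousMap.id Y)) (k : NullHtpy (ContinuousMap.id Z)) :
    NullHtpy (ContinuousMap.id (Y × Z)) where
  hom := ⟨fun p => (h.hom (p.1.1, p.2), k.hom (p.1.2, p.2)), by fun_prop⟩
  pt := (h.pt, k.pt)
  hom_zero y := Prod.ext (h.hom_zero y.1) (k.hom_zero y.2)
  hom_one y := Prod.ext (h.hom_one y.1) (k.hom_one y.2)

end NullHtpy

/-- The vertex `0` of a standard simplex. -/
def Spx.vertexZero (i : ℕ) : Spx i := ⟨Pi.single 0 1, single_mem_stdSimplex ℝ 0⟩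

lemma coneSimplex_face_zero_eq_id (i : ℕ) :
    (NullHtpy.spx (Spx.vertexZero (i + 1))).coneSimplex (faceMap i 0) = ContinuousMap.id _ := by
  ext x : 1
  obtain ⟨⟨s, τ⟩, rfl⟩ := joinMap_surjective i x
  rw [NullHtpy.coneSimplex_joinMap]
  refine Subtype.ext (funext fun l => ?_)
  rw [NullHtpy.spx_hom, faceMap_zero_eq_joinMap]
  refine Fin.cases ?_ (fun m => ?_) l <;> simp [Spx.vertexZero]

namespace RC

variable {Y Z : Type} [TopologicalSpace Y] [TopologicalSpace Z]

lemma of_eq_map_id {i : ℕ} (σ : Sing Y i) : of σ = map σ (i + 1) (of (ContinuousMap.id _)) := by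
  simp

theorem rbdry_rbdry (d : ℕ) (c : RC Y (d + 2)) : rbdry Y d (rbdry Y (d + 1) c) = 0 := by
  induction d generalizing Y with
  | zero =>
    refine LinearMap.congr_fun (f := (rbdry Y 0).comp (rbdry Y 1)) (g := 0)
      (hom_ext fun σ => ?_) c
    simp [Fin.sum_univ_two]
  | succ d ih =>
    refine LinearMap.congr_fun (f := (rbdry Y (d + 1)).comp (rbdry Y (d + 2))) (g := 0)
      (hom_ext fun σ => ?_) c
    rw [LinearMap.comp_apply, of_eq_map_id, rbdry_map, rbdry_map, ← coneSimplex_face_zero_eq_id,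
      ← NullHtpy.cone_of, NullHtpy.rbdry_cone, map_id, map_sub, NullHtpy.rbdry_cone, map_id, ih]
    simp

/-- A contractible space has vanishing reduced homology. -/
lemma exists_rbdry_eq (h : NullHtpy (ContinuousMap.id Y)) (d : ℕ) (c : RC Y (d + 1))
    (hc : rbdry Y d c = 0) : ∃ b, rbdry Y (d + 1) b = c :=
  ⟨h.cone (d + 1) c, by simp [h.rbdry_cone, hc, map_id]⟩

/-! ### Acyclic models -/

/-- Families of operators from chains in `Y` to chains in `Y × [0, 1]`. -/
abbrev CylOp (d e : ℕ) : Type 1 :=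
  ∀ (Y : Type) [TopologicalSpace Y], RC Y d →ₗ[ℤ] RC (Y × unitInterval) e

/-- The continuous map `f × id` of cylinders. -/
abbrev cylMap (f : C(Y, Z)) : C(Y × unitInterval, Z × unitInterval) :=
  f.prodMap (ContinuousMap.id _)

/-- Naturality of a family of operators. -/
def CylOp.IsNat {d e : ℕ} (T : CylOp d e) : Prop :=
  ∀ {Y Z : Type} [TopologicalSpace Y] [TopologicalSpace Z] (f : C(Y, Z)) (c : RC Y d),
    T Z (map f d c) = map (cylMap f) e (T Y c)

/-- The natural family determined by its value on the identity of a simplex. -/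
def CylOp.ofModel {i e : ℕ} (m : RC (Spx i × unitInterval) e) : CylOp (i + 1) e :=
  fun _ _ => lift fun σ => map (cylMap σ) e m

lemma CylOp.isNat_ofModel {i e : ℕ} (m : RC (Spx i × unitInterval) e) :
    (CylOp.ofModel m).IsNat := by
  intro Y Z _ _ f c
  refine LinearMap.congr_fun (f := (ofModel m Z).comp (map f (i + 1)))
    (g := (map (cylMap f) e).comp (ofModel m Y)) (hom_ext fun σ => ?_) c
  simp only [ofModel, LinearMap.comp_apply, map_of, lift_of, map_map]
  rfl

/-- A natural chain map from chains in `Y` to chains in `Y × [0, 1]` that vanishes in the lowest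
degree is naturally null-homotopic. -/
theorem exists_natural_homotopy (Φ : ∀ d, CylOp d d) (hnat : ∀ d, (Φ d).IsNat)
    (hzero : ∀ (Y : Type) [TopologicalSpace Y] c, Φ 0 Y c = 0)
    (hchain : ∀ (d : ℕ) (Y : Type) [TopologicalSpace Y] (c : RC Y (d + 1)),
      rbdry _ d (Φ (d + 1) Y c) = Φ d Y (rbdry Y d c)) :
    ∃ D : ∀ d, CylOp d (d + 1), (∀ d, (D d).IsNat) ∧
      ∀ (d : ℕ) (Y : Type) [TopologicalSpace Y] (c : RC Y (d + 1)),
        rbdry _ (d + 1) (D (d + 1) Y c) = Φ (d + 1) Y c - D d Y (rbdry Y d c) := by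
  let Good (d : ℕ) (T : CylOp d (d + 1)) : Prop := T.IsNat ∧
    ∀ (Y : Type) [TopologicalSpace Y] (c : RC Y (d + 1)),
      rbdry _ d (T Y (rbdry Y d c)) = rbdry _ d (Φ (d + 1) Y c)
  have step : ∀ (d : ℕ) (T : CylOp d (d + 1)), Good d T → ∃ T' : CylOp (d + 1) (d + 2),
      Good (d + 1) T' ∧ ∀ (Y : Type) [TopologicalSpace Y] (c : RC Y (d + 1)),
        rbdry _ (d + 1) (T' Y c) = Φ (d + 1) Y c - T Y (rbdry Y d c) := by
    rintro d T ⟨hT, hgood⟩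
    let e : RC (Spx d) (d + 1) := of (ContinuousMap.id _)
    obtain ⟨m, hm⟩ := exists_rbdry_eq
      ((NullHtpy.spx (Spx.vertexZero d)).prod
        (NullHtpy.ofStarConvex (b := (0 : ℝ)) (by simp) ((convex_Icc 0 1).starConvex (by simp))))
      d (Φ (d + 1) _ e - T _ (rbdry _ d e)) (by rw [map_sub, hgood, sub_self])
    have key : ∀ (Y : Type) [TopologicalSpace Y] (c : RC Y (d + 1)),
        rbdry _ (d + 1) (CylOp.ofModel m Y c) = Φ (d + 1) Y c - T Y (rbdry Y d c) := by
      intro Y _ c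
      refine LinearMap.congr_fun (f := (rbdry _ (d + 1)).comp (CylOp.ofModel m Y))
        (g := Φ (d + 1) Y - (T Y).comp (rbdry Y d)) (hom_ext fun σ => ?_) c
      simp only [CylOp.ofModel, LinearMap.comp_apply, lift_of, LinearMap.sub_apply]
      rw [rbdry_map, hm, map_sub, ← hnat, ← hT, ← rbdry_map]
      simp only [e, map_of, ContinuousMap.comp_id]
    refine ⟨CylOp.ofModel m, ⟨CylOp.isNat_ofModel m, fun Y _ c => ?_⟩, key⟩
    rw [key, rbdry_rbdry, hchain]
    simp
  let D : ∀ d, {T : CylOp d (d + 1) // Good d T} := fun d => Nat.rec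
    ⟨fun _ _ => 0, fun _ _ => by simp, fun Y _ c => by simp [hchain, hzero]⟩
    (fun d T => ⟨(step d T.1 T.2).choose, (step d T.1 T.2).choose_spec.1⟩) d
  exact ⟨fun d => (D d).1, fun d => (D d).2.1,
    fun d => (step d (D d).1 (D d).2).choose_spec.2⟩

/-- The inclusion of `Y` as the slice of height `t` of the cylinder. -/
def slice (t : unitInterval) : C(Y, Y × unitInterval) := ⟨fun y => (y, t), by fun_prop⟩

lemma cylMap_comp_slice (f : C(Y, Z)) (t : unitInterval) :
    (cylMap f).comp (slice t) = (slice t).comp f := rfl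

/-- The two ends of a cylinder induce chain homotopic maps. -/
theorem exists_cylinder_homotopy (Y : Type) [TopologicalSpace Y] :
    ∃ D : ∀ d, RC Y d →ₗ[ℤ] RC (Y × unitInterval) (d + 1), ∀ (d : ℕ) (c : RC Y (d + 1)),
      rbdry _ (d + 1) (D (d + 1) c) =
        map (slice 1) (d + 1) c - map (slice 0) (d + 1) c - D d (rbdry Y d c) := by
  obtain ⟨D, -, hD⟩ := exists_natural_homotopy
    (fun d Y _ => map (slice 1) d - map (slice 0) d)
    (fun d Y Z _ _ f c => by
      simp only [LinearMap.sub_apply, map_sub, map_map, cylMap_comp_slice])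
    (fun Y _ c => sub_self _)
    (fun d Y _ c => by simp only [LinearMap.sub_apply, map_sub, rbdry_map])
  exact ⟨fun d => D d Y, fun d c => hD d Y c⟩

end RC

/-- A linear map that matches two submodules and is surjective modulo the second one
identifies the quotients. -/
lemma Submodule.nonempty_quotient_equiv {R M N : Type} [Ring R] [AddCommGroup M] [Module R M]
    [AddCommGroup N] [Module R N] {P : Submodule R M} {Q : Submodule R N} (φ : M →ₗ[R] N)
    (hinj : ∀ m, φ m ∈ Q ↔ m ∈ P) (hsurj : ∀ n, ∃ m, φ m - n ∈ Q) :
    Nonempty ((M ⧸ P) ≃+ (N ⧸ Q)) := by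
  refine ⟨(LinearEquiv.ofBijective (P.mapQ Q φ fun m hm => (hinj m).2 hm) ⟨?_, ?_⟩).toAddEquiv⟩
  · rw [← LinearMap.ker_eq_bot, LinearMap.ker_eq_bot']
    intro x
    obtain ⟨m, rfl⟩ := P.mkQ_surjective x
    simp [Submodule.mapQ_apply, hinj]
  · intro y
    obtain ⟨n, rfl⟩ := Q.mkQ_surjective y
    obtain ⟨m, hm⟩ := hsurj n
    exact ⟨P.mkQ m, by simpa [Submodule.mapQ_apply] using (Submodule.Quotient.eq Q).2 hm⟩

section HomotopyInvariance

variable {Y Z : Type} [TopologicalSpace Y] [TopologicalSpace Z]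

lemma mem_boundaries {i : ℕ} (z : LinearMap.ker (rbdry Y i)) :
    z ∈ Submodule.comap (LinearMap.ker (rbdry Y i)).subtype (LinearMap.range (rbdry Y (i + 1))) ↔
      ∃ b, rbdry Y (i + 1) b = z.1 := Iff.rfl

/-- Homotopic maps agree on cycles up to boundaries. -/
theorem exists_rbdry_eq_map_sub_map {f g : C(Y, Z)} (h : f.Homotopic g) (i : ℕ)
    (c : RC Y (i + 1)) (hc : rbdry Y i c = 0) :
    ∃ b, rbdry Z (i + 1) b = RC.map g (i + 1) c - RC.map f (i + 1) c := by
  obtain ⟨H⟩ := h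
  obtain ⟨D, hD⟩ := RC.exists_cylinder_homotopy Y
  let K : C(Y × unitInterval, Z) := H.toContinuousMap.comp ContinuousMap.prodSwap
  have h0 : K.comp (RC.slice 0) = f := by ext y; exact H.apply_zero y
  have h1 : K.comp (RC.slice 1) = g := by ext y; exact H.apply_one y
  refine ⟨RC.map K _ (D (i + 1) c), ?_⟩
  rw [RC.rbdry_map, hD, hc, map_zero, sub_zero, map_sub, RC.map_map, RC.map_map, h0, h1]

/-- Homotopy equivalent spaces have isomorphic reduced homology. -/
theorem RedHomology.nonempty_equiv_of_homotopyEquiv (e : ContinuousMap.HomotopyEquiv Y Z) (i : ℕ) :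
    Nonempty (RedHomology Y i ≃+ RedHomology Z i) := by
  have hker : ∀ c ∈ LinearMap.ker (rbdry Y i),
      RC.map e.toFun (i + 1) c ∈ LinearMap.ker (rbdry Z i) := fun c hc => by
    rw [LinearMap.mem_ker] at hc ⊢
    rw [RC.rbdry_map, hc, map_zero]
  refine Submodule.nonempty_quotient_equiv ((RC.map e.toFun (i + 1)).restrict hker)
    (fun z => ?_) fun z => ?_
  · rw [mem_boundaries, mem_boundaries]
    constructor
    · rintro ⟨b, hb⟩
      obtain ⟨b', hb'⟩ := exists_rbdry_eq_map_sub_map e.left_inv i z.1 z.2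
      refine ⟨RC.map e.invFun _ b + b', ?_⟩
      rw [map_add, RC.rbdry_map, hb, hb', LinearMap.restrict_apply, RC.map_map, RC.map_id]
      abel
    · rintro ⟨b, hb⟩
      exact ⟨RC.map e.toFun _ b, by rw [RC.rbdry_map, hb]; rfl⟩
  · obtain ⟨b, hb⟩ := exists_rbdry_eq_map_sub_map e.right_inv i z.1 z.2
    refine ⟨⟨RC.map e.invFun _ z.1, ?_⟩, ?_⟩
    · rw [LinearMap.mem_ker, RC.rbdry_map, LinearMap.mem_ker.1 z.2, map_zero]
    · rw [mem_boundaries]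
      refine ⟨-b, ?_⟩
      rw [map_neg, hb, RC.map_id]
      simp [LinearMap.restrict_apply, RC.map_map]

end HomotopyInvariance

end

/-! ### Barycentric subdivision -/

noncomputable section

/-- The barycenter of a standard simplex. -/
def Spx.barycenter (i : ℕ) : Spx i := ⟨fun _ => 1 / ((i : ℝ) + 1), fun _ => by positivity, by
  have : (i : ℝ) + 1 ≠ 0 := by positivity
  simp [this]⟩

namespace RC

variable {Y Z : Type} [TopologicalSpace Y] [TopologicalSpace Z]

/-- Barycentric subdivision. -/
def sd : ∀ (d : ℕ) (Y : Type) [TopologicalSpace Y], RC Y d →ₗ[ℤ] RC Y d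
  | 0, _, _ => LinearMap.id
  | (i + 1), _, _ => lift fun σ => map σ (i + 1)
      ((NullHtpy.spx (Spx.barycenter i)).cone i
        (sd i (Spx i) (rbdry (Spx i) i (of (ContinuousMap.id _)))))

/-- The subdivision of the identity of a simplex. -/
def sdModel (i : ℕ) : RC (Spx i) (i + 1) :=
  (NullHtpy.spx (Spx.barycenter i)).cone i
    (sd i (Spx i) (rbdry (Spx i) i (of (ContinuousMap.id _))))

lemma sd_zero (c : RC Y 0) : sd 0 Y c = c := by
  rw [sd]; rfl

lemma sd_of {i : ℕ} (σ : Sing Y i) : sd (i + 1) Y (of σ) = map σ (i + 1) (sdModel i) := by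
  rw [sd, lift_of, sdModel]

lemma sd_map (f : C(Y, Z)) (d : ℕ) (c : RC Y d) : sd d Z (map f d c) = map f d (sd d Y c) := by
  cases d with
  | zero => rw [sd_zero, sd_zero]
  | succ i =>
    refine LinearMap.congr_fun (f := (sd (i + 1) Z).comp (map f (i + 1)))
      (g := (map f (i + 1)).comp (sd (i + 1) Y)) (hom_ext fun σ => ?_) c
    simp only [LinearMap.comp_apply, map_of, sd_of, map_map]

lemma rbdry_sd (d : ℕ) (c : RC Y (d + 1)) :
    rbdry Y d (sd (d + 1) Y c) = sd d Y (rbdry Y d c) := by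
  induction d generalizing Y with
  | zero =>
    refine LinearMap.congr_fun (f := (rbdry Y 0).comp (sd 1 Y)) (g := (sd 0 Y).comp (rbdry Y 0))
      (hom_ext fun σ => ?_) c
    rw [LinearMap.comp_apply, LinearMap.comp_apply, sd_of, rbdry_map, sdModel,
      NullHtpy.rbdry_cone_zero, map_id, ← sd_map, ← rbdry_map, ← of_eq_map_id]
  | succ d ih =>
    refine LinearMap.congr_fun (f := (rbdry Y (d + 1)).comp (sd (d + 2) Y))
      (g := (sd (d + 1) Y).comp (rbdry Y (d + 1))) (hom_ext fun σ => ?_) c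
    rw [LinearMap.comp_apply, LinearMap.comp_apply, sd_of, rbdry_map, sdModel,
      NullHtpy.rbdry_cone, map_id, ih, rbdry_rbdry, map_zero, map_zero, sub_zero, ← sd_map,
      ← rbdry_map, ← of_eq_map_id]

/-- Subdivision is naturally chain homotopic to the identity. -/
theorem exists_sd_homotopy :
    ∃ T : ∀ (d : ℕ) (Y : Type) [TopologicalSpace Y], RC Y d →ₗ[ℤ] RC Y (d + 1),
      (∀ (d : ℕ) (Y Z : Type) [TopologicalSpace Y] [TopologicalSpace Z] (f : C(Y, Z)) (c : RC Y d),
        T d Z (map f d c) = map f (d + 1) (T d Y c)) ∧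
      ∀ (d : ℕ) (Y : Type) [TopologicalSpace Y] (c : RC Y (d + 1)),
        rbdry Y (d + 1) (T (d + 1) Y c) = sd (d + 1) Y c - c - T d Y (rbdry Y d c) := by
  obtain ⟨D, hnat, hD⟩ := exists_natural_homotopy
    (fun d Y _ => (map (slice 0) d).comp (sd d Y) - map (slice 0) d)
    (fun d Y Z _ _ f c => by
      simp only [LinearMap.sub_apply, LinearMap.comp_apply, map_sub, sd_map, map_map,
        cylMap_comp_slice])
    (fun Y _ c => by simp [sd_zero])
    (fun d Y _ c => by
      simp only [LinearMap.sub_apply, LinearMap.comp_apply, map_sub, rbdry_map, rbdry_sd])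
  refine ⟨fun d Y _ => (map ContinuousMap.fst (d + 1)).comp (D d Y), fun d Y Z _ _ f c => ?_,
    fun d Y _ c => ?_⟩
  · simp only [LinearMap.comp_apply]
    rw [hnat, map_map, map_map]
    rfl
  · have h0 : (ContinuousMap.fst : C(Y × unitInterval, Y)).comp (slice 0) = ContinuousMap.id Y :=
      rfl
    simp only [LinearMap.comp_apply]
    rw [rbdry_map, hD, map_sub, LinearMap.sub_apply, map_sub, LinearMap.comp_apply, map_map,
      map_map, h0, map_id, map_id]

/-! ### Supports of chains -/

/-- Chains that are combinations of the simplices in a given set. -/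
def supported {i : ℕ} (S : Set (Sing Y i)) : Submodule ℤ (RC Y (i + 1)) :=
  Submodule.span ℤ (of '' S)

lemma of_mem_supported {i : ℕ} {S : Set (Sing Y i)} {σ : Sing Y i} (h : σ ∈ S) :
    of σ ∈ supported S := Submodule.subset_span ⟨σ, h, rfl⟩

lemma supported_univ {i : ℕ} (c : RC Y (i + 1)) : c ∈ supported (Set.univ : Set (Sing Y i)) := by
  refine Finsupp.induction_linear (motive := fun c : Sing Y i →₀ ℤ =>
    (c : RC Y (i + 1)) ∈ supported (Set.univ : Set (Sing Y i))) c (Submodule.zero_mem _)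
    (fun _ _ => Submodule.add_mem _) fun σ n => ?_
  have : (Finsupp.single σ n : Sing Y i →₀ ℤ) = n • Finsupp.single σ (1 : ℤ) := by simp
  rw [this]
  exact Submodule.smul_mem _ n (of_mem_supported (Set.mem_univ σ))

lemma apply_mem_of_mem_supported {M : Type} [AddCommGroup M] [Module ℤ M] {i : ℕ}
    {S : Set (Sing Y i)} (φ : RC Y (i + 1) →ₗ[ℤ] M) {P : Submodule ℤ M}
    (h : ∀ σ ∈ S, φ (of σ) ∈ P) {c : RC Y (i + 1)} (hc : c ∈ supported S) : φ c ∈ P := by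
  have : supported S ≤ P.comap φ := by
    rw [supported, Submodule.span_le]
    rintro _ ⟨σ, hσ, rfl⟩
    exact h σ hσ
  exact this hc

/-! ### Subdivisions are small -/

/-- The `ℓ¹` distance. -/
def l1 {n : ℕ} (x y : Fin n → ℝ) : ℝ := ∑ m, |x m - y m|

lemma dist_le_l1 {n : ℕ} (x y : Fin n → ℝ) : dist x y ≤ l1 x y := by
  refine (dist_pi_le_iff (Finset.sum_nonneg fun _ _ => abs_nonneg _)).2 fun m => ?_
  exact Finset.single_le_sum (f := fun m => |x m - y m|) (fun _ _ => abs_nonneg _)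
    (Finset.mem_univ m)

lemma l1_le_two {i : ℕ} (x y : Spx i) : l1 x.1 y.1 ≤ 2 := by
  calc l1 x.1 y.1 ≤ ∑ m, (x.1 m + y.1 m) := Finset.sum_le_sum fun m _ => by
        have := x.2.1 m
        have := y.2.1 m
        rw [abs_le]; constructor <;> linarith
    _ = 2 := by rw [Finset.sum_add_distrib, x.2.2, y.2.2]; norm_num

lemma l1_comm {n : ℕ} (x y : Fin n → ℝ) : l1 x y = l1 y x :=
  Finset.sum_congr rfl fun _ _ => abs_sub_comm _ _

lemma l1_faceMap {i : ℕ} (j : Fin (i + 2)) (x y : Spx i) :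
    l1 (faceMap i j x).1 (faceMap i j y).1 = l1 x.1 y.1 := by
  rw [l1, Fin.sum_univ_succAbove _ j]
  simp [l1]

lemma l1_barycenter {i : ℕ} (x : Spx i) :
    l1 (Spx.barycenter i).1 x.1 ≤ 2 * ((i : ℝ) / (i + 1)) := by
  have hn : (0 : ℝ) < (i : ℝ) + 1 := by positivity
  have hbound : ∀ m, |(Spx.barycenter i).1 m - x.1 m| ≤
      1 / ((i : ℝ) + 1) + x.1 m - 2 * (1 / ((i : ℝ) + 1)) * x.1 m := by
    intro m
    have h0 := x.2.1 m
    have h1 : x.1 m ≤ 1 := by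
      rw [← x.2.2]
      exact Finset.single_le_sum (fun m _ => x.2.1 m) (Finset.mem_univ m)
    have hq : 1 / ((i : ℝ) + 1) ≤ 1 := by rw [div_le_one hn]; linarith [Nat.cast_nonneg (α := ℝ) i]
    have hq0 : 0 < 1 / ((i : ℝ) + 1) := by positivity
    change |1 / ((i : ℝ) + 1) - x.1 m| ≤ _
    rw [abs_le]
    constructor <;> nlinarith
  refine (Finset.sum_le_sum fun m _ => hbound m).trans_eq ?_
  rw [Finset.sum_sub_distrib, Finset.sum_add_distrib, ← Finset.mul_sum, x.2.2]
  simp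
  field_simp
  ring

lemma sum_mul_le_of_sum_eq_zero {n : ℕ} (w A : Fin (n + 1) → ℝ) {r : ℝ} (hw : ∑ m, w m = 0)
    (hA : ∀ m m', |A m - A m'| ≤ 2 * r) : ∑ m, w m * A m ≤ r * ∑ m, |w m| := by
  obtain ⟨p, -, hp⟩ := Finset.exists_max_image Finset.univ A ⟨0, Finset.mem_univ _⟩
  obtain ⟨q, -, hq⟩ := Finset.exists_min_image Finset.univ A ⟨0, Finset.mem_univ _⟩
  have hpq := (abs_le.1 (hA p q)).2
  calc ∑ m, w m * A m = ∑ m, w m * (A m - (A p + A q) / 2) := by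
        simp only [mul_sub, Finset.sum_sub_distrib, ← Finset.sum_mul, hw]; ring
    _ ≤ ∑ m, |w m| * r := Finset.sum_le_sum fun m _ => by
        refine (le_abs_self _).trans ?_
        rw [abs_mul]
        refine mul_le_mul_of_nonneg_left (abs_le.2 ?_) (abs_nonneg _)
        have := hp m (Finset.mem_univ m)
        have := hq m (Finset.mem_univ m)
        constructor <;> linarith
    _ = r * ∑ m, |w m| := by rw [← Finset.sum_mul, mul_comm]

/-- A singular simplex of a standard simplex that is affine, with vertices at mutual
`ℓ¹` distance at most `2 r`. -/
def IsAffine {k i : ℕ} (r : ℝ) (σ : Sing (Spx k) i) : Prop :=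
  ∃ v : Fin (i + 1) → Spx k, (∀ x l, (σ x).1 l = ∑ m, x.1 m * (v m).1 l) ∧
    ∀ m m', l1 (v m).1 (v m').1 ≤ 2 * r

lemma IsAffine.l1_le {k i : ℕ} {r : ℝ} {σ : Sing (Spx k) i} (h : IsAffine r σ) (x y : Spx i) :
    l1 (σ x).1 (σ y).1 ≤ r * l1 x.1 y.1 := by
  obtain ⟨v, hv, hr⟩ := h
  let s : Fin (k + 1) → ℝ := fun l => SignType.sign ((σ x).1 l - (σ y).1 l)
  have hs : ∀ l (t : ℝ), s l * t ≤ |t| := by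
    intro l t
    rcases lt_trichotomy ((σ x).1 l - (σ y).1 l) 0 with h | h | h
    · simpa [s, sign_neg h] using neg_le_abs t
    · simp [s, h]
    · simpa [s, sign_pos h] using le_abs_self t
  have key := sum_mul_le_of_sum_eq_zero (fun m => x.1 m - y.1 m)
    (fun m => ∑ l, s l * (v m).1 l) (r := r)
    (by rw [Finset.sum_sub_distrib, x.2.2, y.2.2, sub_self]) fun m m' => by
      have aux : ∀ m m', (∑ l, s l * (v m).1 l) - ∑ l, s l * (v m').1 l ≤ 2 * r := by
        intro m m'
        rw [← Finset.sum_sub_distrib]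
        refine (Finset.sum_le_sum fun l _ => ?_).trans (hr m m')
        rw [← mul_sub]
        exact hs l _
      exact abs_sub_le_iff.2 ⟨aux m m', aux m' m⟩
  refine le_trans (le_of_eq ?_) key
  have : ∀ l, |(σ x).1 l - (σ y).1 l| = ∑ m, (x.1 m - y.1 m) * (s l * (v m).1 l) := by
    intro l
    rw [← sign_mul_self]
    change s l * _ = _
    rw [hv, hv, ← Finset.sum_sub_distrib, Finset.mul_sum]
    exact Finset.sum_congr rfl fun m _ => by ring
  simp only [l1, this]
  rw [Finset.sum_comm]
  simp only [Finset.mul_sum]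

lemma IsAffine.faceMap_comp {k i : ℕ} {r : ℝ} {σ : Sing (Spx k) i} (h : IsAffine r σ)
    (j : Fin (k + 2)) : IsAffine r ((faceMap k j).comp σ) := by
  obtain ⟨v, hv, hr⟩ := h
  refine ⟨fun m => faceMap k j (v m), fun x l => ?_, fun m m' => by rw [l1_faceMap]; exact hr m m'⟩
  rcases Fin.eq_self_or_eq_succAbove j l with rfl | ⟨l, rfl⟩
  · simp
  · simp [hv]

lemma IsAffine.coneSimplex {k i : ℕ} {r r' : ℝ} {σ : Sing (Spx k) i} (h : IsAffine r σ)
    (b : Spx k) (hb : ∀ x : Spx k, l1 b.1 x.1 ≤ 2 * r') (hr' : 0 ≤ r') (hrr' : r ≤ r') :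
    IsAffine r' ((NullHtpy.spx b).coneSimplex σ) := by
  obtain ⟨v, hv, hr⟩ := h
  refine ⟨Fin.cons b v, fun x l => ?_, fun m m' => ?_⟩
  · obtain ⟨⟨s, τ⟩, rfl⟩ := joinMap_surjective i x
    rw [NullHtpy.coneSimplex_joinMap, NullHtpy.spx_hom, Fin.sum_univ_succ]
    simp [hv, Finset.mul_sum, mul_assoc]
  · refine Fin.cases ?_ (fun m => ?_) m <;> refine Fin.cases ?_ (fun m' => ?_) m'
    · simpa [l1] using hr'
    · exact hb _
    · rw [l1_comm]; exact hb _
    · exact (hr m m').trans (by linarith)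

lemma sdModel_mem_supported (i : ℕ) :
    sdModel i ∈ supported {σ : Sing (Spx i) i | IsAffine ((i : ℝ) / (i + 1)) σ} := by
  induction i with
  | zero =>
    rw [sdModel, sd_zero, rbdry_zero_of, NullHtpy.cone_zero_one]
    refine of_mem_supported ⟨fun _ => Spx.barycenter 0, fun x l => ?_, fun m m' => by simp [l1]⟩
    rw [← Finset.sum_mul, x.2.2, one_mul]
    rfl
  | succ i ih =>
    rw [sdModel, rbdry_succ_of, map_sum, map_sum]
    refine Submodule.sum_mem _ fun j _ => ?_
    rw [map_smul, map_smul]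
    refine Submodule.smul_mem _ _ ?_
    rw [sd_of]
    refine apply_mem_of_mem_supported
      (((NullHtpy.spx (Spx.barycenter (i + 1))).cone (i + 1)).comp
        (map ((ContinuousMap.id (Spx (i + 1))).comp (faceMap i j)) (i + 1))) (fun σ hσ => ?_) ih
    rw [LinearMap.comp_apply, map_of, NullHtpy.cone_of]
    refine of_mem_supported ?_
    refine (IsAffine.faceMap_comp hσ j).coneSimplex _ (fun x => l1_barycenter x) (by positivity) ?_
    rw [div_le_div_iff₀ (by positivity) (by positivity)]
    push_cast
    nlinarith

lemma iterate_sd_of_mem {i : ℕ} (σ : Sing Y i) (n : ℕ) :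
    (sd (i + 1) Y)^[n] (of σ) ∈ supported {κ | ∃ τ : Sing (Spx i) i, κ = σ.comp τ ∧
      ∀ x y, l1 (τ x).1 (τ y).1 ≤ ((i : ℝ) / (i + 1)) ^ n * l1 x.1 y.1} := by
  induction n with
  | zero => exact of_mem_supported ⟨ContinuousMap.id _, by simp, by simp⟩
  | succ n ih =>
    rw [Function.iterate_succ_apply']
    refine apply_mem_of_mem_supported (sd (i + 1) Y) ?_ ih
    rintro _ ⟨τ, rfl, hτ⟩
    rw [sd_of]
    refine apply_mem_of_mem_supported (map (σ.comp τ) (i + 1)) (fun τ' hτ' => ?_)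
      (sdModel_mem_supported i)
    rw [map_of]
    refine of_mem_supported ⟨τ.comp τ', by rw [ContinuousMap.comp_assoc], fun x y => ?_⟩
    refine (hτ _ _).trans ?_
    rw [pow_succ, mul_assoc]
    exact mul_le_mul_of_nonneg_left (IsAffine.l1_le hτ' x y) (by positivity)

/-- Iterated subdivisions of a simplex are eventually subordinate to an open cover. -/
lemma exists_iterate_sd_of_mem {i : ℕ} (σ : Sing Y i) {ι : Type} {U : ι → Set Y}
    (hU : ∀ a, IsOpen (U a)) (hcov : ⋃ a, U a = Set.univ) :
    ∃ n, (sd (i + 1) Y)^[n] (of σ) ∈ supported {κ | ∃ a, Set.range κ ⊆ U a} := by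
  obtain ⟨δ, hδ, h⟩ := lebesgue_number_lemma_of_metric (s := (Set.univ : Set (Spx i)))
    (c := fun a => σ ⁻¹' U a) isCompact_univ (fun a => (hU a).preimage σ.continuous)
    (by rw [← Set.preimage_iUnion, hcov]; simp)
  have hlt : (i : ℝ) / (i + 1) < 1 := by rw [div_lt_one (by positivity)]; linarith
  obtain ⟨n, hn⟩ := exists_pow_lt_of_lt_one (half_pos hδ) hlt
  refine ⟨n, Submodule.span_mono (Set.image_mono ?_) (iterate_sd_of_mem σ n)⟩
  rintro _ ⟨τ, rfl, hτ⟩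
  obtain ⟨a, ha⟩ := h (τ (Spx.vertexZero i)) (Set.mem_univ _)
  refine ⟨a, ?_⟩
  rintro _ ⟨x, rfl⟩
  refine ha ?_
  rw [Metric.mem_ball, Subtype.dist_eq]
  refine ((dist_le_l1 _ _).trans (hτ _ _)).trans_lt ?_
  have := l1_le_two x (Spx.vertexZero i)
  have hp : 0 ≤ ((i : ℝ) / (i + 1)) ^ n := by positivity
  nlinarith

end RC

end

/-! ### Small chains -/

noncomputable section

/-- The quotient of a submodule `K` by its intersection with `P`. -/
def Submodule.SubQuot {R M : Type} [Ring R] [AddCommGroup M] [Module R M]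
    (K P : Submodule R M) : Type := K ⧸ Submodule.comap K.subtype P

instance {R M : Type} [Ring R] [AddCommGroup M] [Module R M] (K P : Submodule R M) :
    AddCommGroup (K.SubQuot P) :=
  inferInstanceAs (AddCommGroup (K ⧸ Submodule.comap K.subtype P))

lemma Submodule.SubQuot.nonempty_equiv {R M N : Type} [Ring R] [AddCommGroup M] [Module R M]
    [AddCommGroup N] [Module R N] {K P : Submodule R M} {L Q : Submodule R N} (φ : M →ₗ[R] N)
    (hφ : ∀ m ∈ K, φ m ∈ L) (hinj : ∀ m ∈ K, φ m ∈ Q ↔ m ∈ P)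
    (hsurj : ∀ n ∈ L, ∃ m ∈ K, φ m - n ∈ Q) : Nonempty (K.SubQuot P ≃+ L.SubQuot Q) :=
  Submodule.nonempty_quotient_equiv (φ.restrict hφ) (fun m => hinj m.1 m.2) fun n =>
    let ⟨m, hm, h⟩ := hsurj n.1 n.2
    ⟨⟨m, hm⟩, h⟩

namespace RC

variable {Y Z : Type} [TopologicalSpace Y] [TopologicalSpace Z]

/-- The inclusion of a subset as a continuous map. -/
abbrev incl (U : Set Y) : C(U, Y) := ⟨Subtype.val, continuous_subtype_val⟩

/-- The chains in a subset. -/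
def within (U : Set Y) (d : ℕ) : Submodule ℤ (RC Y d) := LinearMap.range (map (incl U) d)

lemma rbdry_mem_within {U : Set Y} {d : ℕ} {c : RC Y (d + 1)} (hc : c ∈ within U (d + 1)) :
    rbdry Y d c ∈ within U d := by
  obtain ⟨c, rfl⟩ := hc
  exact ⟨rbdry _ d c, (rbdry_map _ _ _).symm⟩

lemma within_zero (U : Set Y) (c : RC Y 0) : c ∈ within U 0 := ⟨c, rfl⟩

lemma of_mem_within {U : Set Y} {i : ℕ} {σ : Sing Y i} (h : Set.range σ ⊆ U) :
    of σ ∈ within U (i + 1) :=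
  ⟨of ⟨fun x => ⟨σ x, h ⟨x, rfl⟩⟩, by fun_prop⟩, by rw [map_of]; rfl⟩

lemma within_succ (U : Set Y) (i : ℕ) :
    within U (i + 1) = supported {σ : Sing Y i | Set.range σ ⊆ U} := by
  apply le_antisymm
  · rintro _ ⟨c, rfl⟩
    refine apply_mem_of_mem_supported (map (incl U) (i + 1)) (fun σ _ => ?_) (supported_univ c)
    rw [map_of]
    refine of_mem_supported ?_
    rintro _ ⟨x, rfl⟩
    exact (σ x).2
  · rw [supported, Submodule.span_le]
    rintro _ ⟨σ, hσ, rfl⟩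
    exact of_mem_within hσ

lemma mem_within_inter {U V : Set Y} {d : ℕ} {c : RC Y d} (hU : c ∈ within U d)
    (hV : c ∈ within V d) : c ∈ within (U ∩ V) d := by
  cases d with
  | zero => exact within_zero _ _
  | succ i =>
    have key : ∀ S : Set (Sing Y i), supported S = Finsupp.supported ℤ ℤ S := fun S =>
      (Finsupp.supported_eq_span_single ℤ S).symm
    rw [within_succ, key] at hU hV ⊢
    have hU' := (Finsupp.mem_supported ℤ _).1 hU
    have hV' := (Finsupp.mem_supported ℤ _).1 hV
    exact (Finsupp.mem_supported ℤ _).2 fun σ hσ => Set.subset_inter (hU' hσ) (hV' hσ)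

lemma map_injective {f : C(Y, Z)} (hf : Function.Injective f) (d : ℕ) :
    Function.Injective (map f d) := by
  cases d with
  | zero => exact fun _ _ h => h
  | succ i =>
    have hcomp : Function.Injective fun σ : Sing Y i => f.comp σ := fun σ τ h => by
      ext x
      exact hf (DFunLike.congr_fun h x)
    have : map f (i + 1) = Finsupp.lmapDomain ℤ ℤ fun σ : Sing Y i => f.comp σ :=
      hom_ext fun σ => by
        rw [map_of]
        exact (Finsupp.mapDomain_single (f := fun σ : Sing Y i => f.comp σ)).symm
    rw [this]
    exact Finsupp.mapDomain_injective hcomp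

lemma map_incl_injective (U : Set Y) (d : ℕ) : Function.Injective (map (incl U) d) :=
  map_injective Subtype.val_injective d

/-- Sums of chains in `U` and chains in `V`. -/
def small (U V : Set Y) (d : ℕ) : Submodule ℤ (RC Y d) := within U d ⊔ within V d

lemma apply_mem_small {d e : ℕ}
    (T : ∀ (Y : Type) [TopologicalSpace Y], RC Y d →ₗ[ℤ] RC Y e)
    (hT : ∀ (Y Z : Type) [TopologicalSpace Y] [TopologicalSpace Z] (f : C(Y, Z)) (c : RC Y d),
      T Z (map f d c) = map f e (T Y c))
    {U V : Set Y} {c : RC Y d} (hc : c ∈ small U V d) : T Y c ∈ small U V e := by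
  obtain ⟨_, ⟨u, rfl⟩, _, ⟨v, rfl⟩, rfl⟩ := Submodule.mem_sup.1 hc
  rw [map_add, hT, hT]
  exact Submodule.add_mem_sup ⟨_, rfl⟩ ⟨_, rfl⟩

lemma sd_mem_small {U V : Set Y} {d : ℕ} {c : RC Y d} (hc : c ∈ small U V d) :
    sd d Y c ∈ small U V d :=
  apply_mem_small (fun Y _ => sd d Y) (fun _ _ _ _ f c => sd_map f d c) hc

lemma exists_pow_sd_mem_small {U V : Set Y} (hU : IsOpen U) (hV : IsOpen V)
    (hcov : U ∪ V = Set.univ) {i : ℕ} (c : RC Y (i + 1)) :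
    ∃ n, ∀ m ≥ n, ((sd (i + 1) Y : Module.End ℤ _) ^ m) c ∈ small U V (i + 1) := by
  have mono : ∀ (c : RC Y (i + 1)) (n : ℕ),
      ((sd (i + 1) Y : Module.End ℤ _) ^ n) c ∈ small U V (i + 1) →
      ∀ m ≥ n, ((sd (i + 1) Y : Module.End ℤ _) ^ m) c ∈ small U V (i + 1) := by
    intro c n hn m hm
    induction m, hm using Nat.le_induction with
    | base => exact hn
    | succ m _ ih =>
      rw [pow_succ']
      exact sd_mem_small ih
  refine Submodule.span_induction (p := fun c _ => ∃ n, ∀ m ≥ n,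
    ((sd (i + 1) Y : Module.End ℤ _) ^ m) c ∈ small U V (i + 1)) ?_ ?_ ?_ ?_ (supported_univ c)
  · rintro _ ⟨σ, -, rfl⟩
    obtain ⟨n, hn⟩ := exists_iterate_sd_of_mem σ (U := fun b : Bool => cond b U V)
      (by rintro (_ | _) <;> assumption) (by rw [← Set.union_eq_iUnion, hcov])
    refine ⟨n, mono _ n ?_⟩
    rw [Module.End.pow_apply]
    refine apply_mem_of_mem_supported LinearMap.id ?_ hn
    rintro κ ⟨_ | _, hκ⟩
    · exact Submodule.mem_sup_right (of_mem_within hκ)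
    · exact Submodule.mem_sup_left (of_mem_within hκ)
  · exact ⟨0, fun m _ => by rw [map_zero]; exact Submodule.zero_mem _⟩
  · rintro c c' - - ⟨n, hn⟩ ⟨n', hn'⟩
    refine ⟨max n n', fun m hm => ?_⟩
    rw [map_add]
    exact Submodule.add_mem _ (hn m (le_of_max_le_left hm)) (hn' m (le_of_max_le_right hm))
  · rintro a c - ⟨n, hn⟩
    refine ⟨n, fun m hm => ?_⟩
    rw [map_smul]
    exact Submodule.smul_mem _ _ (hn m hm)

lemma exists_rbdry_eq_pow_sd_sub {d : ℕ} (c : RC Y (d + 1)) (hc : rbdry Y d c = 0) (n : ℕ) :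
    rbdry Y d (((sd (d + 1) Y : Module.End ℤ _) ^ n) c) = 0 ∧
    ∃ b, rbdry Y (d + 1) b = ((sd (d + 1) Y : Module.End ℤ _) ^ n) c - c ∧
      ∀ U V : Set Y, c ∈ small U V (d + 1) → b ∈ small U V (d + 2) ∧
        ((sd (d + 1) Y : Module.End ℤ _) ^ n) c ∈ small U V (d + 1) := by
  obtain ⟨T, hT, hbT⟩ := exists_sd_homotopy
  induction n with
  | zero =>
    exact ⟨by simpa using hc, 0, by simp, fun U V h => ⟨Submodule.zero_mem _, by simpa using h⟩⟩
  | succ n ih =>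
    obtain ⟨hz, b, hb, hs⟩ := ih
    rw [pow_succ', Module.End.mul_apply]
    refine ⟨by rw [rbdry_sd, hz, map_zero],
      b + T (d + 1) Y (((sd (d + 1) Y : Module.End ℤ _) ^ n) c),
      ?_, fun U V h => ?_⟩
    · rw [map_add, hb, hbT, hz, map_zero]
      abel
    · exact ⟨Submodule.add_mem _ (hs U V h).1
        (apply_mem_small (fun Y _ => T (d + 1) Y) (hT (d + 1)) (hs U V h).2),
        sd_mem_small (hs U V h).2⟩

/-- Every cycle is homologous to a small one. -/
lemma exists_small_homologous {U V : Set Y} (hU : IsOpen U) (hV : IsOpen V)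
    (hcov : U ∪ V = Set.univ) {d : ℕ} (c : RC Y (d + 1)) (hc : rbdry Y d c = 0) :
    ∃ c' ∈ small U V (d + 1), rbdry Y d c' = 0 ∧ ∃ b, rbdry Y (d + 1) b = c' - c := by
  obtain ⟨n, hn⟩ := exists_pow_sd_mem_small hU hV hcov c
  obtain ⟨hz, b, hb, -⟩ := exists_rbdry_eq_pow_sd_sub c hc n
  exact ⟨_, hn n le_rfl, hz, b, hb⟩

/-- A small boundary is the boundary of a small chain. -/
lemma exists_small_rbdry_eq {U V : Set Y} (hU : IsOpen U) (hV : IsOpen V)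
    (hcov : U ∪ V = Set.univ) {d : ℕ} (b : RC Y (d + 2))
    (hc : rbdry Y (d + 1) b ∈ small U V (d + 1)) :
    ∃ b' ∈ small U V (d + 2), rbdry Y (d + 1) b' = rbdry Y (d + 1) b := by
  obtain ⟨n, hn⟩ := exists_pow_sd_mem_small hU hV hcov b
  obtain ⟨-, a, ha, hs⟩ := exists_rbdry_eq_pow_sd_sub _ (rbdry_rbdry d b) n
  refine ⟨((sd (d + 2) Y : Module.End ℤ _) ^ n) b - a,
    Submodule.sub_mem _ (hn n le_rfl) (hs U V hc).1, ?_⟩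
  have hpow : ∀ n, rbdry Y (d + 1) (((sd (d + 2) Y : Module.End ℤ _) ^ n) b) =
      ((sd (d + 1) Y : Module.End ℤ _) ^ n) (rbdry Y (d + 1) b) := by
    intro n
    induction n with
    | zero => simp
    | succ n ih =>
      rw [pow_succ', pow_succ', Module.End.mul_apply, Module.End.mul_apply, rbdry_sd, ih]
  rw [map_sub, ha, hpow]
  abel

/-! ### The Mayer–Vietoris isomorphism -/

/-- The cycles of the augmented chain complex. -/
def cycles (Y : Type) [TopologicalSpace Y] : ∀ d, Submodule ℤ (RC Y d)
  | 0 => ⊤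
  | (d + 1) => LinearMap.ker (rbdry Y d)

/-- The homology of the augmented chain complex; in degree `i + 1` it is `RedHomology Y i`. -/
abbrev homology (Y : Type) [TopologicalSpace Y] (d : ℕ) : Type :=
  (cycles Y d).SubQuot (LinearMap.range (rbdry Y d))

lemma rbdry_cone_of_mem_cycles {f : C(Y, Z)} (h : NullHtpy f) {d : ℕ} {c : RC Y d}
    (hc : c ∈ cycles Y d) : rbdry Z d (h.cone d c) = map f d c := by
  cases d with
  | zero => exact h.rbdry_cone_zero c
  | succ d => rw [h.rbdry_cone, LinearMap.mem_ker.1 hc, map_zero, sub_zero]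

lemma mem_cycles_of_map_mem {f : C(Y, Z)} (hf : Function.Injective f) {d : ℕ} {c : RC Y d}
    (hc : map f d c ∈ cycles Z d) : c ∈ cycles Y d := by
  cases d with
  | zero => trivial
  | succ d =>
    refine map_injective hf d ?_
    rw [← rbdry_map, LinearMap.mem_ker.1 hc, map_zero]

lemma rbdry_mem_cycles {d : ℕ} (c : RC Y (d + 1)) : rbdry Y d c ∈ cycles Y d := by
  cases d with
  | zero => trivial
  | succ d => exact rbdry_rbdry d c

lemma map_mem_cycles (f : C(Y, Z)) {d : ℕ} {c : RC Y d} (hc : c ∈ cycles Y d) :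
    map f d c ∈ cycles Z d := by
  cases d with
  | zero => trivial
  | succ d =>
    rw [cycles, LinearMap.mem_ker, rbdry_map, LinearMap.mem_ker.1 hc, map_zero]

/-- For an open cover by two contractible sets, the homology of the space is that of the
intersection with a shift. -/
theorem homology_equiv_of_cover {U V : Set Y} (hU : IsOpen U) (hV : IsOpen V)
    (hcov : U ∪ V = Set.univ) (h : NullHtpy (ContinuousMap.id U))
    (k : NullHtpy (ContinuousMap.id V)) (d : ℕ) :
    Nonempty (homology (U ∩ V : Set Y) d ≃+ homology Y (d + 1)) := by
  let iU : C((U ∩ V : Set Y), U) := ⟨fun y => ⟨y.1, y.2.1⟩, by fun_prop⟩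
  let iV : C((U ∩ V : Set Y), V) := ⟨fun y => ⟨y.1, y.2.2⟩, by fun_prop⟩
  have hiU : ∀ d (c : RC (U ∩ V : Set Y) d), map (incl U) d (map iU d c) =
      map (incl (U ∩ V)) d c := fun d c => by rw [map_map]; rfl
  have hiV : ∀ d (c : RC (U ∩ V : Set Y) d), map (incl V) d (map iV d c) =
      map (incl (U ∩ V)) d c := fun d c => by rw [map_map]; rfl
  let aU : RC (U ∩ V : Set Y) d →ₗ[ℤ] RC Y (d + 1) :=
    (map (incl U) (d + 1)).comp ((h.cone d).comp (map iU d))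
  let aV : RC (U ∩ V : Set Y) d →ₗ[ℤ] RC Y (d + 1) :=
    (map (incl V) (d + 1)).comp ((k.cone d).comp (map iV d))
  have haU : ∀ z ∈ cycles (U ∩ V : Set Y) d, rbdry Y d (aU z) = map (incl (U ∩ V)) d z := by
    intro z hz
    simp only [aU, LinearMap.comp_apply]
    rw [rbdry_map, rbdry_cone_of_mem_cycles h (map_mem_cycles _ hz), map_id, hiU]
  have haV : ∀ z ∈ cycles (U ∩ V : Set Y) d, rbdry Y d (aV z) = map (incl (U ∩ V)) d z := by
    intro z hz
    simp only [aV, LinearMap.comp_apply]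
    rw [rbdry_map, rbdry_cone_of_mem_cycles k (map_mem_cycles _ hz), map_id, hiV]
  have hker : ∀ z ∈ cycles (U ∩ V : Set Y) d, (aU - aV) z ∈ cycles Y (d + 1) := fun z hz => by
    rw [cycles, LinearMap.mem_ker, LinearMap.sub_apply, map_sub, haU z hz, haV z hz, sub_self]
  refine Submodule.SubQuot.nonempty_equiv (aU - aV) hker (fun z hz => ?_) fun y hy => ?_
  · change (∃ c, rbdry Y (d + 1) c = aU z - aV z) ↔ ∃ w, rbdry _ d w = z
    constructor
    · rintro ⟨c, hc⟩
      obtain ⟨c', hc', hcc'⟩ := exists_small_rbdry_eq hU hV hcov c (by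
        rw [hc]
        exact Submodule.sub_mem _ (Submodule.mem_sup_left ⟨_, rfl⟩)
          (Submodule.mem_sup_right ⟨_, rfl⟩))
      obtain ⟨u, hu, v, hv, rfl⟩ := Submodule.mem_sup.1 hc'
      have heq : aU z - rbdry Y (d + 1) u = aV z + rbdry Y (d + 1) v := by
        rw [map_add, hc] at hcc'
        rw [sub_eq_iff_eq_add, add_assoc, add_comm (rbdry Y (d + 1) v), hcc', add_sub_cancel]
      obtain ⟨w, hw⟩ : aU z - rbdry Y (d + 1) u ∈ within (U ∩ V) (d + 1) := by
        refine mem_within_inter (Submodule.sub_mem _ ⟨_, rfl⟩ (rbdry_mem_within hu)) ?_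
        rw [heq]
        exact Submodule.add_mem _ ⟨_, rfl⟩ (rbdry_mem_within hv)
      refine ⟨w, map_incl_injective _ _ ?_⟩
      rw [← rbdry_map, hw, map_sub, haU _ hz, rbdry_rbdry, sub_zero]
    · rintro ⟨w, hw⟩
      refine ⟨map (incl V) _ (k.cone (d + 1) (map iV _ w)) -
        map (incl U) _ (h.cone (d + 1) (map iU _ w)), ?_⟩
      rw [map_sub, rbdry_map, rbdry_map, h.rbdry_cone, k.rbdry_cone, map_id, map_id, map_sub,
        map_sub, hiU, hiV, rbdry_map, rbdry_map, hw]
      simp only [aU, aV, LinearMap.comp_apply]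
      abel
  · obtain ⟨y', hy', hz', b, hb⟩ := exists_small_homologous hU hV hcov y hy
    obtain ⟨_, ⟨u, rfl⟩, _, ⟨v, rfl⟩, rfl⟩ := Submodule.mem_sup.1 hy'
    rw [map_add, rbdry_map, rbdry_map, add_eq_zero_iff_eq_neg] at hz'
    obtain ⟨z, hz⟩ : map (incl U) d (rbdry _ d u) ∈ within (U ∩ V) d := by
      refine mem_within_inter ⟨_, rfl⟩ ?_
      rw [hz']
      exact Submodule.neg_mem _ ⟨_, rfl⟩
    have hzU : map iU d z = rbdry _ d u := map_incl_injective _ _ (by rw [hiU, hz])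
    have hzV : map iV d z = - rbdry _ d v :=
      map_incl_injective _ _ (by rw [hiV, hz, hz', map_neg])
    have hzc : z ∈ cycles _ d := mem_cycles_of_map_mem (f := iU)
      (fun x y hxy => Subtype.ext (congrArg (fun t => t.1) hxy)) (hzU ▸ rbdry_mem_cycles u)
    obtain ⟨p, hp⟩ := exists_rbdry_eq h d (h.cone d (map iU d z) - u) (by
      rw [map_sub, rbdry_cone_of_mem_cycles h (map_mem_cycles _ hzc), map_id, hzU, sub_self])
    obtain ⟨q, hq⟩ := exists_rbdry_eq k d (k.cone d (map iV d z) + v) (by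
      rw [map_add, rbdry_cone_of_mem_cycles k (map_mem_cycles _ hzc), map_id, hzV, neg_add_cancel])
    refine ⟨z, hzc, map (incl U) _ p - map (incl V) _ q + b, ?_⟩
    change _ = aU z - aV z - y
    rw [map_add, map_sub, rbdry_map, rbdry_map, hp, hq, hb, map_sub, map_add]
    simp only [aU, aV, LinearMap.comp_apply]
    abel

end RC

end

/-! ### Spheres -/

noncomputable section

/-- Transport of a contraction along a homeomorphism. -/
def NullHtpy.ofHomeomorph {Y Z : Type} [TopologicalSpace Y] [TopologicalSpace Z] (e : Y ≃ₜ Z)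
    (h : NullHtpy (ContinuousMap.id Z)) : NullHtpy (ContinuousMap.id Y) where
  hom := ⟨fun p => e.symm (h.hom (e p.1, p.2)), by fun_prop⟩
  pt := e.symm h.pt
  hom_zero y := by simp [h.hom_zero]
  hom_one y := by simp [h.hom_one]

namespace RC

variable {Y Z : Type} [TopologicalSpace Y] [TopologicalSpace Z]

theorem homology_equiv_of_homotopyEquiv (e : ContinuousMap.HomotopyEquiv Y Z) (d : ℕ) :
    Nonempty (homology Y d ≃+ homology Z d) := by
  cases d with
  | zero =>
    refine Submodule.SubQuot.nonempty_equiv (map e.toFun 0) (fun _ _ => trivial)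
      (fun m _ => ⟨?_, ?_⟩) fun n _ => ⟨n, trivial, ?_⟩
    · rintro ⟨c, hc⟩
      exact ⟨map e.invFun 1 c, by rw [rbdry_map, hc]; rfl⟩
    · rintro ⟨c, rfl⟩
      exact ⟨map e.toFun 1 c, rbdry_map _ _ _⟩
    · exact ⟨0, by rw [map_zero]; exact (sub_self (n : RC Z 0)).symm⟩
  | succ i => exact RedHomology.nonempty_equiv_of_homotopyEquiv e i

/-- The homology of the augmented chain complex is `ℤ`, concentrated in index `n`. -/
def IsSphereLike (Y : Type) [TopologicalSpace Y] (n : ℕ) : Prop :=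
  Nonempty (homology Y n ≃+ ℤ) ∧ ∀ d, d ≠ n → Subsingleton (homology Y d)

lemma IsSphereLike.of_homotopyEquiv {n : ℕ} (h : IsSphereLike Y n)
    (e : ContinuousMap.HomotopyEquiv Y Z) : IsSphereLike Z n := by
  refine ⟨?_, fun d hd => ?_⟩
  · obtain ⟨f⟩ := homology_equiv_of_homotopyEquiv e n
    exact h.1.map f.symm.trans
  · obtain ⟨f⟩ := homology_equiv_of_homotopyEquiv e d
    have := h.2 d hd
    exact f.symm.toEquiv.subsingleton

lemma isSphereLike_of_isEmpty [IsEmpty Y] : IsSphereLike Y 0 := by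
  have hsub : ∀ i, Subsingleton (RC Y (i + 1)) := fun i => by
    have : IsEmpty (Sing Y i) := ⟨fun σ => IsEmpty.false (σ (Spx.vertexZero i))⟩
    exact inferInstanceAs (Subsingleton (Sing Y i →₀ ℤ))
  refine ⟨?_, fun d hd => ?_⟩
  · have e := Submodule.SubQuot.nonempty_equiv (K := cycles Y 0)
      (P := LinearMap.range (rbdry Y 0)) (L := (⊤ : Submodule ℤ ℤ)) (Q := ⊥)
      (show RC Y 0 →ₗ[ℤ] ℤ from (LinearMap.id : ℤ →ₗ[ℤ] ℤ)) (fun _ _ => trivial) (fun m _ => ?_)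
      fun n _ => ⟨n, trivial, ?_⟩
    · have e' : (⊤ : Submodule ℤ ℤ).SubQuot (⊥ : Submodule ℤ ℤ) ≃+ ℤ :=
        ((Submodule.quotEquivOfEqBot _ (by simp)).toAddEquiv).trans
          (Submodule.topEquiv (R := ℤ) (M := ℤ)).toAddEquiv
      exact e.map fun e => e.trans e'
    · constructor
      · intro h
        exact ⟨0, by rw [map_zero]; exact ((Submodule.mem_bot ℤ).1 h).symm⟩
      · rintro ⟨c, rfl⟩
        rw [@Subsingleton.elim _ (hsub 0) c 0, map_zero]
        exact Submodule.zero_mem _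
    · exact (Submodule.mem_bot ℤ).2 (sub_self n)
  · obtain ⟨i, rfl⟩ := Nat.exists_eq_succ_of_ne_zero hd
    have := hsub i
    have : Subsingleton (cycles Y (i + 1)) := inferInstance
    exact (Submodule.mkQ_surjective (Submodule.comap (cycles Y (i + 1)).subtype
      (LinearMap.range (rbdry Y (i + 1))))).subsingleton

lemma subsingleton_homology_zero [Nonempty Y] : Subsingleton (homology Y 0) := by
  obtain ⟨y⟩ := ‹Nonempty Y›
  have htop : LinearMap.range (rbdry Y 0) = ⊤ := by
    refine (Submodule.eq_top_iff').2 fun m => ?_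
    refine ⟨(show ℤ from m) • of (ContinuousMap.const _ y), ?_⟩
    rw [map_smul, rbdry_zero_of]
    exact mul_one (show ℤ from m)
  have : Subsingleton (cycles Y 0 ⧸
      Submodule.comap (cycles Y 0).subtype (LinearMap.range (rbdry Y 0))) := by
    rw [htop, Submodule.comap_top]
    infer_instance
  exact this

lemma IsSphereLike.of_cover [Nonempty Y] {U V : Set Y} (hU : IsOpen U) (hV : IsOpen V)
    (hcov : U ∪ V = Set.univ) (h : NullHtpy (ContinuousMap.id U))
    (k : NullHtpy (ContinuousMap.id V)) {n : ℕ} (hn : IsSphereLike (U ∩ V : Set Y) n) :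
    IsSphereLike Y (n + 1) := by
  refine ⟨?_, fun d hd => ?_⟩
  · obtain ⟨f⟩ := homology_equiv_of_cover hU hV hcov h k n
    exact hn.1.map f.symm.trans
  · cases d with
    | zero => exact subsingleton_homology_zero
    | succ d =>
      obtain ⟨f⟩ := homology_equiv_of_cover hU hV hcov h k d
      have := hn.2 d (fun h => hd (congrArg _ h))
      exact f.symm.toEquiv.subsingleton

end RC

/-- The product with a contractible space. -/
def ContinuousMap.HomotopyEquiv.prodContractible (Y C : Type) [TopologicalSpace Y]
    [TopologicalSpace C] [ContractibleSpace C] : ContinuousMap.HomotopyEquiv (Y × C) Y :=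
  ((ContinuousMap.HomotopyEquiv.refl Y).prodCongr (ContractibleSpace.hequiv C Unit).some).trans
    (Homeomorph.prodPUnit Y).toHomotopyEquiv

/-- A subset of a subspace, as a subset of the whole space. -/
def Homeomorph.subtypeSubtype {E : Type} [TopologicalSpace E] {S W : Set E} (h : S ⊆ W) :
    {p : W | p.1 ∈ S} ≃ₜ S where
  toFun p := ⟨p.1.1, p.2⟩
  invFun p := ⟨⟨p.1, h p.2⟩, p.2⟩
  left_inv _ := rfl
  right_inv _ := rfl

section Suspension

variable {E : Type} [NormedAddCommGroup E] [NormedSpace ℝ E]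

lemma starConvex_ne_or_pos (s : ℝ) (hs : s ≠ 0) :
    StarConvex ℝ ((0 : E), s) {p : E × ℝ | p.1 ≠ 0 ∨ 0 < s * p.2} := by
  rintro ⟨e, r⟩ hp a b ha hb hab
  by_cases he : b • e = 0
  · right
    have hss : 0 < s * s := mul_self_pos.2 hs
    simp only [Prod.smul_mk, Prod.mk_add_mk, smul_eq_mul]
    rcases smul_eq_zero.1 he with rfl | rfl
    · obtain rfl : a = 1 := by linarith
      simpa using hss
    · have hr : 0 < s * r := hp.resolve_left fun h => h rfl
      rcases ha.eq_or_lt with rfl | ha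
      · obtain rfl : b = 1 := by linarith
        simpa using hr
      · nlinarith [mul_pos ha hss, mul_nonneg hb hr.le]
  · left
    simpa using he

theorem isSphereLike_compl_zero_prod {n : ℕ} (h : RC.IsSphereLike ({0}ᶜ : Set E) n) :
    RC.IsSphereLike ({0}ᶜ : Set (E × ℝ)) (n + 1) := by
  let S (s : ℝ) : Set (E × ℝ) := {p | p.1 ≠ 0 ∨ 0 < s * p.2}
  let U (s : ℝ) : Set ({0}ᶜ : Set (E × ℝ)) := {p | p.1 ∈ S s}
  have hS : ∀ s, S s ⊆ {0}ᶜ := by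
    rintro s ⟨e, r⟩ hp h0
    obtain ⟨rfl, rfl⟩ : e = 0 ∧ r = 0 := Prod.mk_eq_zero.1 h0
    simp [S] at hp
  have hopen : ∀ s, IsOpen (U s) := fun s => by
    have h1 : IsOpen {p : E × ℝ | p.1 ≠ 0} := isOpen_ne_fun continuous_fst continuous_const
    have h2 : IsOpen {p : E × ℝ | 0 < s * p.2} := isOpen_lt (by fun_prop) (by fun_prop)
    exact (h1.union h2).preimage continuous_subtype_val
  have hnull : ∀ s, s ≠ 0 → NullHtpy (ContinuousMap.id (U s)) := fun s hs =>
    NullHtpy.ofHomeomorph (Homeomorph.subtypeSubtype (hS s)) (NullHtpy.ofStarConvex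
      (Or.inr (mul_self_pos.2 hs)) (starConvex_ne_or_pos s hs))
  have hcov : U 1 ∪ U (-1) = Set.univ := by
    refine Set.eq_univ_of_forall ?_
    rintro ⟨⟨e, r⟩, hp⟩
    by_cases he : e = 0
    · have hr : r ≠ 0 := fun hr => hp (by simp [he, hr])
      rcases hr.lt_or_gt with hr | hr
      · exact Or.inr (Or.inr (by simpa using hr))
      · exact Or.inl (Or.inr (by simpa using hr))
    · exact Or.inl (Or.inl he)
  have hinter : ∀ p ∈ U 1 ∩ U (-1), p.1.1 ≠ 0 := by
    rintro ⟨⟨e, r⟩, hp⟩ ⟨h1 | h1, h2 | h2⟩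
    · exact h1
    · exact h1
    · exact h2
    · simp only [one_mul, neg_mul, Left.neg_pos_iff] at h1 h2
      exact absurd h1 h2.not_gt
  let e : (U 1 ∩ U (-1) : Set _) ≃ₜ ({0}ᶜ : Set E) × ℝ :=
    { toFun := fun p => (⟨p.1.1.1, hinter p.1 p.2⟩, p.1.1.2)
      invFun := fun q => ⟨⟨(q.1.1, q.2), fun h => q.1.2 (congrArg Prod.fst h)⟩,
        Or.inl q.1.2, Or.inl q.1.2⟩
      left_inv := fun _ => rfl
      right_inv := fun _ => rfl
      continuous_toFun := by fun_prop
      continuous_invFun := by fun_prop }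
  have : Nonempty ({0}ᶜ : Set (E × ℝ)) := ⟨⟨(0, 1), by simp⟩⟩
  exact RC.IsSphereLike.of_cover (hopen 1) (hopen (-1)) hcov (hnull 1 one_ne_zero)
    (hnull (-1) (by norm_num)) (h.of_homotopyEquiv
      ((ContinuousMap.HomotopyEquiv.prodContractible _ ℝ).symm.trans e.symm.toHomotopyEquiv))

end Suspension

theorem isSphereLike_compl_zero (n : ℕ) : ∀ (E : Type) [NormedAddCommGroup E] [NormedSpace ℝ E]
    [FiniteDimensional ℝ E], Module.finrank ℝ E = n → RC.IsSphereLike ({0}ᶜ : Set E) n := by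
  induction n with
  | zero =>
    intro E _ _ _ hE
    have := Module.finrank_zero_iff.1 hE
    have : IsEmpty ({0}ᶜ : Set E) := ⟨fun x => x.2 (Subsingleton.elim _ _)⟩
    exact RC.isSphereLike_of_isEmpty
  | succ n ih =>
    intro E _ _ _ hE
    have hdim : Module.finrank ℝ ((Fin n → ℝ) × ℝ) = Module.finrank ℝ E := by
      rw [hE, Module.finrank_prod, Module.finrank_fin_fun, Module.finrank_self]
    have e : ((Fin n → ℝ) × ℝ) ≃L[ℝ] E := ContinuousLinearEquiv.ofFinrankEq hdim
    have h := isSphereLike_compl_zero_prod (ih (Fin n → ℝ) (by simp))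
    exact h.of_homotopyEquiv (e.toHomeomorph.subtype fun x => by
      change ¬ x = 0 ↔ ¬ e x = 0
      simp).toHomotopyEquiv

theorem isSphereLike_sphere (n : ℕ) :
    RC.IsSphereLike (Metric.sphere (0 : EuclideanSpace ℝ (Fin n)) 1) n := by
  have := (convex_Ioi (0 : ℝ)).contractibleSpace Set.nonempty_Ioi
  exact (isSphereLike_compl_zero n (EuclideanSpace ℝ (Fin n)) (by simp)).of_homotopyEquiv
    ((homeomorphUnitSphereProd _).toHomotopyEquiv.trans
      (ContinuousMap.HomotopyEquiv.prodContractible _ _))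

theorem isSphereLike_onePoint (V : Type) [NormedAddCommGroup V] [NormedSpace ℝ V]
    [FiniteDimensional ℝ V] {n : ℕ} (h : Module.finrank ℝ V = n) :
    RC.IsSphereLike (OnePoint V) (n + 1) :=
  (isSphereLike_sphere (n + 1)).of_homotopyEquiv
    (onePointEquivSphereOfFinrankEq (ι := Fin (n + 1)) (by simp [h])).symm.toHomotopyEquiv

end

/-! ### A gauge function on triples of points of the half-plane -/

noncomputable section

namespace TriConf

/-- Triples of points of the half-plane. -/
abbrev Triple : Type := Fin 3 → Psi

/-- The smallest of three numbers. -/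
def lo (u : Fin 3 → ℝ) : ℝ := Finset.univ.inf' Finset.univ_nonempty u

/-- The largest of three numbers. -/
def hi (u : Fin 3 → ℝ) : ℝ := Finset.univ.sup' Finset.univ_nonempty u

lemma lo_le (u : Fin 3 → ℝ) (i : Fin 3) : lo u ≤ u i := Finset.inf'_le _ (Finset.mem_univ i)

lemma le_hi (u : Fin 3 → ℝ) (i : Fin 3) : u i ≤ hi u := Finset.le_sup' u (Finset.mem_univ i)

lemma lo_le_hi (u : Fin 3 → ℝ) : lo u ≤ hi u := (lo_le u 0).trans (le_hi u 0)

lemma exists_eq_lo (u : Fin 3 → ℝ) : ∃ i, u i = lo u := by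
  obtain ⟨i, -, h⟩ := Finset.exists_mem_eq_inf' Finset.univ_nonempty u
  exact ⟨i, h.symm⟩

lemma exists_eq_hi (u : Fin 3 → ℝ) : ∃ i, u i = hi u := by
  obtain ⟨i, -, h⟩ := Finset.exists_mem_eq_sup' Finset.univ_nonempty u
  exact ⟨i, h.symm⟩

lemma lo_comp (u : Fin 3 → ℝ) (σ : Equiv.Perm (Fin 3)) : lo (u ∘ σ) = lo u := by
  obtain ⟨i, hi⟩ := exists_eq_lo u
  obtain ⟨j, hj⟩ := exists_eq_lo (u ∘ σ)
  refine le_antisymm ?_ (hj ▸ lo_le u (σ j))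
  simpa [hi] using lo_le (u ∘ σ) (σ.symm i)

lemma hi_comp (u : Fin 3 → ℝ) (σ : Equiv.Perm (Fin 3)) : hi (u ∘ σ) = hi u := by
  obtain ⟨i, hi⟩ := exists_eq_hi u
  obtain ⟨j, hj⟩ := exists_eq_hi (u ∘ σ)
  refine le_antisymm (hj ▸ le_hi u (σ j)) ?_
  simpa [hi] using le_hi (u ∘ σ) (σ.symm i)

@[fun_prop]
lemma continuous_lo : Continuous lo :=
  Continuous.finset_inf'_apply _ fun i _ => continuous_apply i

@[fun_prop]
lemma continuous_hi : Continuous hi :=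
  Continuous.finset_sup'_apply _ fun i _ => continuous_apply i

/-- The first coordinates of a triple of points. -/
def fsts (z : Triple) : Fin 3 → ℝ := fun i => (z i).1.1

/-- The second coordinates of a triple of points. -/
def snds (z : Triple) : Fin 3 → ℝ := fun i => (z i).1.2

@[fun_prop]
lemma continuous_fsts : Continuous fsts := by
  unfold fsts
  fun_prop

@[fun_prop]
lemma continuous_snds : Continuous snds := by
  unfold snds
  fun_prop

/-- A measure of the size of a triple. -/
def extent (z : Triple) : ℝ := max (-lo (fsts z)) (hi (snds z))

lemma extent_nonneg (z : Triple) : 0 ≤ extent z := by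
  have h1 : lo (fsts z) ≤ hi (snds z) :=
    (lo_le (fsts z) 0).trans ((z 0).2.trans (le_hi (snds z) 0))
  by_contra h
  obtain ⟨h2, h3⟩ := max_lt_iff.1 (not_le.1 h)
  linarith

lemma isCompact_extent_le (R : ℝ) : IsCompact {z : Triple | extent z ≤ R} := by
  have hcl : Topology.IsClosedEmbedding fun p : Psi => p.1 :=
    (isClosed_le continuous_fst continuous_snd).isClosedEmbedding_subtypeVal
  have hK : IsCompact ((fun p : Psi => p.1) ⁻¹' (Set.Icc (-R) R ×ˢ Set.Icc (-R) R)) :=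
    hcl.isCompact_preimage (isCompact_Icc.prod isCompact_Icc)
  refine (isCompact_univ_pi fun _ : Fin 3 => hK).of_isClosed_subset
    (isClosed_le (by unfold extent; fun_prop) continuous_const) ?_
  rintro z hz i -
  obtain ⟨h1, h2⟩ := max_le_iff.1 (show extent z ≤ R from hz)
  have h3 := lo_le (fsts z) i
  have h4 := le_hi (snds z) i
  have h5 : fsts z i ≤ snds z i := (z i).2
  exact ⟨⟨by change -R ≤ fsts z i; linarith, by change fsts z i ≤ R; linarith⟩,
    ⟨by change -R ≤ snds z i; linarith, by change snds z i ≤ R; linarith⟩⟩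

/-- The distance of two points. -/
def sep (p q : Psi) : ℝ := |p.1.1 - q.1.1| + |p.1.2 - q.1.2|

/-- The failure of three points to be of the form `(a, b)`, `(a, c)`, `(b, c)`. -/
def tri (p q r : Psi) : ℝ := |p.1.1 - q.1.1| + |q.1.2 - r.1.2| + |p.1.2 - r.1.1|

lemma sep_nonneg (p q : Psi) : 0 ≤ sep p q := by unfold sep; positivity

lemma tri_nonneg (p q r : Psi) : 0 ≤ tri p q r := by unfold tri; positivity

lemma sep_eq_zero {p q : Psi} : sep p q = 0 ↔ p = q := by
  rw [sep, add_eq_zero_iff_of_nonneg (abs_nonneg _) (abs_nonneg _), abs_eq_zero, abs_eq_zero,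
    sub_eq_zero, sub_eq_zero, ← Prod.ext_iff, Subtype.ext_iff]

lemma tri_eq_zero {p q r : Psi} :
    tri p q r = 0 ↔ p.1.1 = q.1.1 ∧ q.1.2 = r.1.2 ∧ p.1.2 = r.1.1 := by
  rw [tri, add_eq_zero_iff_of_nonneg (by positivity) (abs_nonneg _),
    add_eq_zero_iff_of_nonneg (abs_nonneg _) (abs_nonneg _), abs_eq_zero, abs_eq_zero, abs_eq_zero,
    sub_eq_zero, sub_eq_zero, sub_eq_zero, and_assoc]

/-- The distance of a triple from the degenerate ones. -/
def nondeg (z : Triple) : ℝ :=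
  Finset.univ.inf' Finset.univ_nonempty fun σ : Equiv.Perm (Fin 3) =>
    min (sep (z (σ 0)) (z (σ 1))) (tri (z (σ 0)) (z (σ 1)) (z (σ 2)))

/-- A continuous function that is positive exactly on the triples that represent a point of the
configuration space outside of `TriSet`, and that tends to `0` at infinity. -/
def gauge (z : Triple) : ℝ := min (1 / (1 + extent z)) (nondeg z)

@[fun_prop]
lemma continuous_gauge : Continuous gauge := by
  unfold gauge
  have h1 : Continuous fun z : Triple => 1 / (1 + extent z) := by
    refine continuous_const.div (by unfold extent; fun_prop) fun z => ?_
    linarith [extent_nonneg z]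
  refine h1.min (Continuous.finset_inf'_apply _ fun σ _ => ?_)
  unfold sep tri
  fun_prop

lemma nondeg_nonneg (z : Triple) : 0 ≤ nondeg z :=
  Finset.le_inf' _ _ fun _ _ => le_min (sep_nonneg _ _) (tri_nonneg _ _ _)

lemma gauge_nonneg (z : Triple) : 0 ≤ gauge z :=
  le_min (div_nonneg zero_le_one (by linarith [extent_nonneg z])) (nondeg_nonneg z)

lemma gauge_le_inv (z : Triple) : gauge z ≤ 1 / (1 + extent z) := min_le_left _ _

lemma gauge_le_sep (z : Triple) {i j : Fin 3} (hij : i ≠ j) : gauge z ≤ sep (z i) (z j) := by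
  have : ∀ i j : Fin 3, i ≠ j → ∃ σ : Equiv.Perm (Fin 3), σ 0 = i ∧ σ 1 = j := by decide
  obtain ⟨σ, rfl, rfl⟩ := this i j hij
  exact (min_le_right _ _).trans ((Finset.inf'_le _ (Finset.mem_univ σ)).trans (min_le_left _ _))

lemma gauge_le_tri (z : Triple) (σ : Equiv.Perm (Fin 3)) :
    gauge z ≤ tri (z (σ 0)) (z (σ 1)) (z (σ 2)) :=
  (min_le_right _ _).trans ((Finset.inf'_le _ (Finset.mem_univ σ)).trans (min_le_right _ _))

lemma gauge_pos_iff {z : Triple} : 0 < gauge z ↔ Function.Injective z ∧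
    ∀ σ : Equiv.Perm (Fin 3), tri (z (σ 0)) (z (σ 1)) (z (σ 2)) ≠ 0 := by
  constructor
  · intro h
    refine ⟨fun i j hij => ?_, fun σ hσ => (h.trans_le (gauge_le_tri z σ)).ne' hσ⟩
    by_contra hne
    exact (h.trans_le (gauge_le_sep z hne)).ne' (sep_eq_zero.2 hij)
  · rintro ⟨hinj, htri⟩
    refine lt_min (div_pos one_pos (by linarith [extent_nonneg z])) ?_
    refine (Finset.lt_inf'_iff _).2 fun σ _ => lt_min ?_ ?_
    · refine (sep_nonneg _ _).lt_of_ne' fun h0 => ?_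
      exact absurd (σ.injective (hinj (sep_eq_zero.1 h0))) (by decide)
    · exact (tri_nonneg _ _ _).lt_of_ne' (htri σ)

lemma gauge_comp (z : Triple) (σ : Equiv.Perm (Fin 3)) : gauge (z ∘ σ) = gauge z := by
  have h1 : extent (z ∘ σ) = extent z := by
    unfold extent
    rw [show fsts (z ∘ σ) = fsts z ∘ σ from rfl, show snds (z ∘ σ) = snds z ∘ σ from rfl, lo_comp,
      hi_comp]
  have h2 : ∀ (z : Triple) (σ : Equiv.Perm (Fin 3)), nondeg z ≤ nondeg (z ∘ σ) := fun z σ =>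
    Finset.le_inf' _ _ fun κ _ => Finset.inf'_le
      (fun σ : Equiv.Perm (Fin 3) =>
        min (sep (z (σ 0)) (z (σ 1))) (tri (z (σ 0)) (z (σ 1)) (z (σ 2))))
      (Finset.mem_univ (σ * κ))
  unfold gauge
  rw [h1, le_antisymm (by simpa [Function.comp_assoc] using h2 (z ∘ σ) σ.symm) (h2 z σ)]

lemma isCompact_le_gauge {ε : ℝ} (hε : 0 < ε) : IsCompact {z | ε ≤ gauge z} := by
  refine (isCompact_extent_le (1 / ε)).of_isClosed_subset
    (isClosed_le continuous_const continuous_gauge) fun z hz => ?_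
  have h1 := (show ε ≤ gauge z from hz).trans (gauge_le_inv z)
  have h2 := extent_nonneg z
  rw [le_div_iff₀ (by linarith)] at h1
  rw [Set.mem_ofPred_eq, le_div_iff₀ hε]
  nlinarith

/-! ### The configuration space as a quotient -/

/-- The complement of `TriSet` in the configuration space. -/
abbrev X : Type := {c : Config Psi 3 // c ∉ TriSet}

lemma mem_triSet_iff (f : InjTuple Psi 3) : Quotient.mk (configSetoid Psi 3) f ∈ TriSet ↔
    ∃ σ : Equiv.Perm (Fin 3), tri (f.1 (σ 0)) (f.1 (σ 1)) (f.1 (σ 2)) = 0 := by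
  constructor
  · rintro ⟨x, y, z, hxy, hyz, g, hfg, hg⟩
    obtain ⟨τ, hτ⟩ := Quotient.exact hfg
    have hf : Set.range f.1 = Set.range g.1 := by
      rw [hτ, Set.range_comp, τ.surjective.range_eq, Set.image_univ]
    rw [← hf] at hg
    obtain ⟨i, hi⟩ : (⟨(x, y), hxy.le⟩ : Psi) ∈ Set.range f.1 := by rw [hg]; simp
    obtain ⟨j, hj⟩ : (⟨(x, z), (hxy.trans hyz).le⟩ : Psi) ∈ Set.range f.1 := by rw [hg]; simp
    obtain ⟨k, hk⟩ : (⟨(y, z), hyz.le⟩ : Psi) ∈ Set.range f.1 := by rw [hg]; simp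
    have : ∀ i j k : Fin 3, i ≠ j → j ≠ k → i ≠ k →
      ∃ σ : Equiv.Perm (Fin 3), σ 0 = i ∧ σ 1 = j ∧ σ 2 = k := by decide
    obtain ⟨σ, rfl, rfl, rfl⟩ := this i j k
      (by rintro rfl; simp [hi] at hj; exact hyz.ne hj)
      (by rintro rfl; simp [hj] at hk; exact hxy.ne hk)
      (by rintro rfl; simp [hi] at hk; exact hxy.ne hk.1)
    exact ⟨σ, tri_eq_zero.2 (by simp [hi, hj, hk])⟩
  · rintro ⟨σ, hσ⟩
    obtain ⟨h1, h2, h3⟩ := tri_eq_zero.1 hσ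
    have hne : ∀ {i j : Fin 3}, i ≠ j → f.1 (σ i) ≠ f.1 (σ j) := fun hij h =>
      hij (σ.injective (f.2 h))
    have h01 := hne (i := 0) (j := 1) (by decide)
    have h12 := hne (i := 1) (j := 2) (by decide)
    have hxy : (f.1 (σ 0)).1.1 < (f.1 (σ 0)).1.2 := (f.1 (σ 0)).2.lt_of_ne fun h =>
      h12 (Subtype.ext (Prod.ext (by rw [← h1, h, h3]) h2))
    have hyz : (f.1 (σ 0)).1.2 < (f.1 (σ 1)).1.2 :=
      lt_of_le_of_ne (by rw [h3, h2]; exact (f.1 (σ 2)).2) fun h =>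
        h01 (Subtype.ext (Prod.ext h1 h))
    refine ⟨_, _, _, hxy, hyz, f, rfl, ?_⟩
    have e0 : (⟨((f.1 (σ 0)).1.1, (f.1 (σ 0)).1.2), hxy.le⟩ : Psi) = f.1 (σ 0) := rfl
    have e1 : (⟨((f.1 (σ 0)).1.1, (f.1 (σ 1)).1.2), (hxy.trans hyz).le⟩ : Psi) = f.1 (σ 1) :=
      Subtype.ext (Prod.ext h1 rfl)
    have e2 : (⟨((f.1 (σ 0)).1.2, (f.1 (σ 1)).1.2), hyz.le⟩ : Psi) = f.1 (σ 2) :=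
      Subtype.ext (Prod.ext h3 h2)
    rw [e0, e1, e2]
    ext p
    constructor
    · rintro ⟨i, rfl⟩
      obtain ⟨j, rfl⟩ := σ.surjective i
      fin_cases j <;> simp
    · rintro (rfl | rfl | rfl) <;> exact ⟨_, rfl⟩

/-- Triples that represent a point of `X`. -/
abbrev M : Type := {z : Triple // 0 < gauge z}

/-- The configuration of a triple. -/
def proj (z : M) : X :=
  ⟨Quotient.mk (configSetoid Psi 3) ⟨z.1, (gauge_pos_iff.1 z.2).1⟩, fun h => by
    obtain ⟨σ, hσ⟩ := (mem_triSet_iff _).1 h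
    exact (gauge_pos_iff.1 z.2).2 σ hσ⟩

lemma proj_eq_iff {z z' : M} :
    proj z = proj z' ↔ ∃ σ : Equiv.Perm (Fin 3), z.1 = z'.1 ∘ σ := by
  rw [proj, proj, Subtype.mk.injEq]
  exact Quotient.eq (r := configSetoid Psi 3)

lemma continuous_proj : Continuous proj :=
  Continuous.subtype_mk (continuous_quotient_mk'.comp (by fun_prop)) _

lemma proj_surjective : Function.Surjective proj := by
  rintro ⟨c, hc⟩
  induction c using Quotient.inductionOn with
  | h f =>
    refine ⟨⟨f.1, gauge_pos_iff.2 ⟨f.2, fun σ hσ => hc ((mem_triSet_iff f).2 ⟨σ, hσ⟩)⟩⟩, rfl⟩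

lemma isOpenMap_configMk :
    IsOpenMap (Quotient.mk (configSetoid Psi 3) : InjTuple Psi 3 → Config Psi 3) := by
  intro U hU
  refine isQuotientMap_quotient_mk'.isOpen_preimage.1 ?_
  have : (Quotient.mk (configSetoid Psi 3) : InjTuple Psi 3 → Config Psi 3) ⁻¹'
      (Quotient.mk (configSetoid Psi 3) '' U) =
      ⋃ σ : Equiv.Perm (Fin 3),
        (fun f : InjTuple Psi 3 => (⟨f.1 ∘ σ, f.2.comp σ.injective⟩ : InjTuple Psi 3)) ⁻¹' U := by
    ext f
    simp only [Set.mem_preimage, Set.mem_image, Set.mem_iUnion]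
    constructor
    · rintro ⟨g, hg, hgf⟩
      obtain ⟨σ, hσ⟩ := Quotient.exact hgf
      refine ⟨σ, ?_⟩
      convert hg
      exact hσ.symm
    · rintro ⟨σ, hσ⟩
      exact ⟨_, hσ, Quotient.sound ⟨σ, rfl⟩⟩
  refine this ▸ isOpen_iUnion fun σ => hU.preimage (Continuous.subtype_mk ?_ _)
  exact continuous_pi fun i => (continuous_apply (σ i)).comp continuous_subtype_val

lemma isOpenMap_proj : IsOpenMap proj := by
  intro U hU
  have h1 : IsOpen ((fun z : M => z.1) '' U) :=
    (isOpen_lt continuous_const continuous_gauge).isOpenMap_subtype_val U hU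
  have h2 := (isOpenMap_configMk _ (h1.preimage (continuous_subtype_val
    (p := fun f : Triple => Function.Injective f)))).preimage
    (continuous_subtype_val (p := fun c : Config Psi 3 => c ∉ TriSet))
  convert h2
  ext c
  constructor
  · rintro ⟨z, hz, rfl⟩
    exact ⟨_, ⟨z, hz, rfl⟩, rfl⟩
  · rintro ⟨f, ⟨z, hz, hzf⟩, hf⟩
    refine ⟨z, hz, Subtype.ext ?_⟩
    rw [← hf]
    exact congrArg (Quotient.mk (configSetoid Psi 3)) (Subtype.ext hzf)

lemma isOpenQuotientMap_proj : IsOpenQuotientMap proj :=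
  ⟨proj_surjective, continuous_proj, isOpenMap_proj⟩

instance : T2Space X := by
  rw [t2Space_iff_of_isOpenQuotientMap isOpenQuotientMap_proj]
  simp only [proj_eq_iff]
  rw [Set.ofPred_exists]
  refine isClosed_iUnion_of_finite fun σ => isClosed_eq (by fun_prop) ?_
  exact continuous_pi fun i => (continuous_apply (σ i)).comp (by fun_prop)

/-- The gauge as a function on the one-point compactification. -/
def gaugeX (c : X) : ℝ :=
  gauge (Function.surjInv proj_surjective c).1

lemma gaugeX_proj (z : M) : gaugeX (proj z) = gauge z.1 := by
  obtain ⟨σ, hσ⟩ := proj_eq_iff.1 (Function.surjInv_eq proj_surjective (proj z))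
  rw [gaugeX, hσ, gauge_comp]

lemma gaugeX_pos (c : X) : 0 < gaugeX c := (Function.surjInv proj_surjective c).2

lemma continuous_gaugeX : Continuous gaugeX := by
  rw [isOpenQuotientMap_proj.isQuotientMap.continuous_iff]
  exact (continuous_gauge.comp continuous_subtype_val).congr fun z => (gaugeX_proj z).symm

lemma isCompact_le_gaugeX {ε : ℝ} (hε : 0 < ε) : IsCompact {c | ε ≤ gaugeX c} := by
  have h1 : IsCompact ((fun z : M => z.1) ⁻¹' {z | ε ≤ gauge z}) :=
    Topology.IsInducing.subtypeVal.isCompact_preimage' (isCompact_le_gauge hε)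
      fun z hz => ⟨⟨z, hε.trans_le hz⟩, rfl⟩
  convert h1.image continuous_proj
  ext c
  obtain ⟨z, rfl⟩ := proj_surjective c
  constructor
  · intro h
    exact ⟨z, by simpa [gaugeX_proj] using h, rfl⟩
  · rintro ⟨z', hz', h⟩
    rw [← h, Set.mem_ofPred_eq, gaugeX_proj]
    exact hz'

instance : WeaklyLocallyCompactSpace X where
  exists_compact_mem_nhds c := ⟨_, isCompact_le_gaugeX (half_pos (gaugeX_pos c)),
    continuous_gaugeX.continuousAt.preimage_mem_nhds (Ici_mem_nhds (half_lt_self (gaugeX_pos c)))⟩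

end TriConf

end

/-! ### The one-point compactification as a quotient -/

noncomputable section

namespace TriConf

open Filter Topology OnePoint

/-- The gauge on the one-point compactification. -/
def gaugeP (c : OnePoint X) : ℝ := c.elim 0 gaugeX

@[simp] lemma gaugeP_infty : gaugeP ∞ = 0 := rfl

@[simp] lemma gaugeP_coe (c : X) : gaugeP c = gaugeX c := rfl

lemma gaugeP_nonneg (c : OnePoint X) : 0 ≤ gaugeP c := by
  induction c using OnePoint.rec with
  | infty => exact le_rfl
  | coe c => exact (gaugeX_pos c).le

lemma gaugeP_eq_zero {c : OnePoint X} : gaugeP c = 0 ↔ c = ∞ := by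
  induction c using OnePoint.rec with
  | infty => simp
  | coe c => simp [(gaugeX_pos c).ne']

@[fun_prop]
lemma continuous_gaugeP : Continuous gaugeP := by
  refine (OnePoint.continuous_iff _).2 ⟨?_, continuous_gaugeX⟩
  refine Metric.tendsto_nhds.2 fun ε hε => ?_
  have hK := isCompact_le_gaugeX hε
  filter_upwards [hK.compl_mem_coclosedCompact_of_isClosed hK.isClosed] with c hc
  have h1 : gaugeX c < ε := not_le.1 hc
  rw [Real.dist_eq, gaugeP_infty, sub_zero, gaugeP_coe, abs_of_pos (gaugeX_pos c)]
  exact h1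

lemma tendsto_infty {α : Type} {l : Filter α} {f : α → OnePoint X}
    (h : Tendsto (fun a => gaugeP (f a)) l (𝓝 0)) : Tendsto f l (𝓝 ∞) := by
  refine OnePoint.hasBasis_nhds_infty.tendsto_right_iff.2 fun K hK => ?_
  rcases K.eq_empty_or_nonempty with rfl | hne
  · exact Eventually.of_forall fun a => by
      induction f a using OnePoint.rec <;> simp
  obtain ⟨c, -, hmin⟩ := hK.2.exists_isMinOn hne continuous_gaugeX.continuousOn
  filter_upwards [h.eventually (gt_mem_nhds (gaugeX_pos c))] with a ha
  induction hfa : f a using OnePoint.rec with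
  | infty => exact Or.inr rfl
  | coe x =>
    refine Or.inl ⟨x, fun hx => ?_, rfl⟩
    rw [hfa] at ha
    exact ha.not_ge (hmin hx)

/-- The configuration of a triple, where degenerate triples are sent to infinity. -/
def conf (z : Triple) : OnePoint X :=
  if h : 0 < gauge z then ((proj ⟨z, h⟩ : X) : OnePoint X) else ∞

lemma conf_of_pos {z : Triple} (h : 0 < gauge z) : conf z = (proj ⟨z, h⟩ : X) := dif_pos h

lemma conf_of_eq_zero {z : Triple} (h : gauge z = 0) : conf z = ∞ := dif_neg h.not_gt

@[simp] lemma gaugeP_conf (z : Triple) : gaugeP (conf z) = gauge z := by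
  rcases (gauge_nonneg z).eq_or_lt with h | h
  · rw [conf_of_eq_zero h.symm, gaugeP_infty, h]
  · rw [conf_of_pos h, gaugeP_coe, gaugeX_proj]

lemma conf_eq_infty {z : Triple} : conf z = ∞ ↔ gauge z = 0 := by
  rw [← gaugeP_eq_zero, gaugeP_conf]

lemma conf_comp (z : Triple) (σ : Equiv.Perm (Fin 3)) : conf (z ∘ σ) = conf z := by
  rcases (gauge_nonneg z).eq_or_lt with h | h
  · rw [conf_of_eq_zero h.symm, conf_of_eq_zero (by rw [gauge_comp, h])]
  · rw [conf_of_pos h, conf_of_pos (by rwa [gauge_comp]), OnePoint.coe_eq_coe, proj_eq_iff]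
    exact ⟨σ, rfl⟩

lemma conf_eq_conf {z z' : Triple} (h : conf z = conf z') :
    gauge z = 0 ∧ gauge z' = 0 ∨ ∃ σ : Equiv.Perm (Fin 3), z = z' ∘ σ := by
  have hg : gauge z = gauge z' := by rw [← gaugeP_conf, h, gaugeP_conf]
  rcases (gauge_nonneg z).eq_or_lt with h0 | h0
  · exact Or.inl ⟨h0.symm, hg ▸ h0.symm⟩
  · rw [conf_of_pos h0, conf_of_pos (hg ▸ h0), OnePoint.coe_eq_coe, proj_eq_iff] at h
    exact Or.inr h

lemma conf_surjective : Function.Surjective conf := by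
  intro c
  induction c using OnePoint.rec with
  | infty =>
    refine ⟨fun _ => ⟨(0, 0), le_rfl⟩, conf_eq_infty.2 ?_⟩
    refine le_antisymm ?_ (gauge_nonneg _)
    exact (gauge_le_sep _ (zero_ne_one : (0 : Fin 3) ≠ 1)).trans (sep_eq_zero.2 rfl).le
  | coe c =>
    obtain ⟨z, rfl⟩ := proj_surjective c
    exact ⟨z.1, conf_of_pos z.2⟩

@[fun_prop]
lemma continuous_conf : Continuous conf := by
  refine continuous_iff_continuousAt.2 fun z => ?_
  rcases (gauge_nonneg z).eq_or_lt with h | h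
  · rw [ContinuousAt, conf_of_eq_zero h.symm]
    refine tendsto_infty ?_
    simp only [gaugeP_conf]
    exact h ▸ continuous_gauge.tendsto z
  · have hopen : IsOpen {z | 0 < gauge z} := isOpen_lt continuous_const continuous_gauge
    refine ContinuousOn.continuousAt (s := {z | 0 < gauge z}) ?_ (hopen.mem_nhds h)
    rw [continuousOn_iff_continuous_domRestrict]
    exact (OnePoint.continuous_coe.comp continuous_proj).congr fun z => (conf_of_pos z.2).symm

/-- A homotopy on triples that is compatible with the passage to configurations descends to the
one-point compactification. -/
theorem exists_descent (K : Triple × unitInterval → OnePoint X) (hK : Continuous K)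
    (hsymm : ∀ (z : Triple) (σ : Equiv.Perm (Fin 3)) τ, K (z ∘ σ, τ) = K (z, τ))
    (hzero : ∀ z τ, gauge z = 0 → K (z, τ) = ∞)
    (hext : ∀ z τ, gaugeP (K (z, τ)) ≤ 1 / (1 + extent z)) :
    ∃ k : C(OnePoint X × unitInterval, OnePoint X), ∀ z τ, k (conf z, τ) = K (z, τ) := by
  let k : OnePoint X × unitInterval → OnePoint X := fun p =>
    K (Function.surjInv conf_surjective p.1, p.2)
  have hk : ∀ z τ, k (conf z, τ) = K (z, τ) := by
    intro z τ
    rcases conf_eq_conf (Function.surjInv_eq conf_surjective (conf z)) with ⟨h, h'⟩ | ⟨σ, hσ⟩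
    · rw [hzero z τ h', ← hzero _ τ h]
    · rw [← hsymm z σ τ, ← hσ]
  refine ⟨⟨k, continuous_iff_continuousAt.2 ?_⟩, hk⟩
  rintro ⟨c, τ⟩
  induction c using OnePoint.rec with
  | coe c =>
    obtain ⟨m, rfl⟩ := proj_surjective c
    have hopen : IsOpenMap
        (Prod.map (fun m : M => (proj m : OnePoint X)) (id : unitInterval → unitInterval)) :=
      (OnePoint.isOpenMap_coe.comp isOpenMap_proj).prodMap IsOpenMap.id
    refine Tendsto.mono_left ?_ (hopen.nhds_le (m, τ))
    rw [tendsto_map'_iff]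
    have hcomp : k ∘ Prod.map (fun m : M => (proj m : OnePoint X)) id =
        fun p : M × unitInterval => K (p.1.1, p.2) := by
      funext p
      rw [← hk, conf_of_pos p.1.2]
      rfl
    rw [hcomp]
    have hcont : Continuous fun p : M × unitInterval => K (p.1.1, p.2) := by fun_prop
    have h0 := congrFun hcomp (m, τ)
    simp only [Function.comp_apply, Prod.map_apply, id] at h0
    rw [h0]
    exact hcont.tendsto (m, τ)
  | infty =>
    have h0 : k (∞, τ) = ∞ := by
      obtain ⟨z, hz⟩ := conf_surjective ∞
      rw [← hz, hk, hz, hzero z τ (conf_eq_infty.1 hz)]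
    rw [ContinuousAt, h0]
    refine tendsto_infty (Metric.tendsto_nhds.2 fun ε hε => ?_)
    obtain ⟨η, hη, h⟩ : ∃ η > 0, ∀ z τ, gauge z < η → gaugeP (K (z, τ)) < ε := by
      let C : Set (Triple × unitInterval) :=
        ({z | extent z ≤ 1 / ε} ×ˢ Set.univ) ∩ {p | ε ≤ gaugeP (K p)}
      have hC : IsCompact C := ((isCompact_extent_le _).prod isCompact_univ).inter_right
        (isClosed_le continuous_const (by fun_prop))
      have hmem : ∀ z τ, ε ≤ gaugeP (K (z, τ)) → (z, τ) ∈ C := by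
        intro z τ hz
        refine ⟨⟨?_, trivial⟩, hz⟩
        have h1 := hz.trans (hext z τ)
        have h2 := extent_nonneg z
        rw [le_div_iff₀ (by linarith)] at h1
        rw [Set.mem_ofPred_eq, le_div_iff₀ hε]
        nlinarith
      rcases C.eq_empty_or_nonempty with hCe | hCn
      · refine ⟨1, one_pos, fun z τ _ => not_le.1 fun hz => ?_⟩
        exact (hCe ▸ hmem z τ hz : (z, τ) ∈ (∅ : Set (Triple × unitInterval)))
      · obtain ⟨p, hp, hmin⟩ := hC.exists_isMinOn hCn
          (continuous_gauge.comp continuous_fst).continuousOn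
        refine ⟨gauge p.1, (gauge_nonneg _).lt_of_ne' fun h0 => ?_, fun z τ hz =>
          not_le.1 fun hz' => hz.not_ge (hmin (hmem z τ hz'))⟩
        have h1 : ε ≤ gaugeP (K (p.1, p.2)) := hp.2
        rw [hzero _ _ h0, gaugeP_infty] at h1
        exact hε.not_ge h1
    have hev : ∀ᶠ p : OnePoint X × unitInterval in 𝓝 (∞, τ), gaugeP p.1 < η :=
      ((continuous_gaugeP.comp continuous_fst).tendsto (∞, τ)).eventually (gt_mem_nhds hη)
    filter_upwards [hev] with p hp
    obtain ⟨c, τ'⟩ := p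
    obtain ⟨z, rfl⟩ := conf_surjective c
    rw [Real.dist_eq, sub_zero, abs_of_nonneg (gaugeP_nonneg _), hk]
    exact h z τ' (by simpa using hp)

/-! ### The cell of chains of four numbers -/

/-- Increasing sequences of four numbers. -/
abbrev Cell : Type := {p : ℝ × ℝ × ℝ × ℝ // p.1 < p.2.1 ∧ p.2.1 < p.2.2.1 ∧ p.2.2.1 < p.2.2.2}

/-- The triple `(x, w), (x, v), (y, v)` of an increasing sequence `x, y, w, v`. -/
def cellTriple (f : Cell) : Triple :=
  ![⟨(f.1.1, f.1.2.2.1), (f.2.1.trans f.2.2.1).le⟩,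
    ⟨(f.1.1, f.1.2.2.2), (f.2.1.trans (f.2.2.1.trans f.2.2.2)).le⟩,
    ⟨(f.1.2.1, f.1.2.2.2), (f.2.2.1.trans f.2.2.2).le⟩]

lemma continuous_cellTriple : Continuous cellTriple := by
  refine continuous_pi fun i => ?_
  fin_cases i
  all_goals
    simp only [cellTriple]
    exact Continuous.subtype_mk (by fun_prop) _

lemma gauge_cellTriple_pos (f : Cell) : 0 < gauge (cellTriple f) := by
  obtain ⟨⟨x, y, w, v⟩, hxy, hyw, hwv⟩ := f
  simp only at hxy hyw hwv
  refine gauge_pos_iff.2 ⟨fun i j hij => ?_, fun σ hσ => ?_⟩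
  · have h1 := congrArg (fun p : Psi => p.1.1) hij
    have h2 := congrArg (fun p : Psi => p.1.2) hij
    fin_cases i <;> fin_cases j <;> simp [cellTriple] at h1 h2 ⊢ <;> linarith
  · obtain ⟨-, -, h⟩ := tri_eq_zero.1 hσ
    generalize σ 0 = i at h
    generalize σ 2 = j at h
    fin_cases i <;> fin_cases j <;> simp [cellTriple] at h <;> linarith

lemma lo_eq {u : Fin 3 → ℝ} {a : ℝ} (h : ∀ i, a ≤ u i) (i : Fin 3) (hi : u i = a) : lo u = a := by
  obtain ⟨j, hj⟩ := exists_eq_lo u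
  exact le_antisymm (hi ▸ lo_le u i) (hj ▸ h j)

lemma hi_eq {u : Fin 3 → ℝ} {a : ℝ} (h : ∀ i, u i ≤ a) (i : Fin 3) (hi : u i = a) :
    TriConf.hi u = a := by
  obtain ⟨j, hj⟩ := exists_eq_hi u
  exact le_antisymm (hj ▸ h j) (hi ▸ le_hi u i)

lemma lo_fsts_cellTriple (f : Cell) : lo (fsts (cellTriple f)) = f.1.1 :=
  lo_eq (fun i => by fin_cases i <;> simp [fsts, cellTriple, f.2.1.le]) 0 rfl

lemma hi_fsts_cellTriple (f : Cell) : hi (fsts (cellTriple f)) = f.1.2.1 :=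
  hi_eq (fun i => by fin_cases i <;> simp [fsts, cellTriple, f.2.1.le]) 2 rfl

lemma lo_snds_cellTriple (f : Cell) : lo (snds (cellTriple f)) = f.1.2.2.1 :=
  lo_eq (fun i => by fin_cases i <;> simp [snds, cellTriple, f.2.2.2.le]) 0 rfl

lemma hi_snds_cellTriple (f : Cell) : hi (snds (cellTriple f)) = f.1.2.2.2 :=
  hi_eq (fun i => by fin_cases i <;> simp [snds, cellTriple, f.2.2.2.le]) 2 rfl

lemma cellTriple_eq_comp {f g : Cell} {σ : Equiv.Perm (Fin 3)}
    (h : cellTriple f = cellTriple g ∘ σ) : f = g := by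
  have h1 : fsts (cellTriple f) = fsts (cellTriple g) ∘ σ := congrArg fsts h
  have h2 : snds (cellTriple f) = snds (cellTriple g) ∘ σ := congrArg snds h
  have hx := lo_fsts_cellTriple f
  have hy := hi_fsts_cellTriple f
  have hw := lo_snds_cellTriple f
  have hv := hi_snds_cellTriple f
  rw [h1, lo_comp, lo_fsts_cellTriple] at hx
  rw [h1, hi_comp, hi_fsts_cellTriple] at hy
  rw [h2, lo_comp, lo_snds_cellTriple] at hw
  rw [h2, hi_comp, hi_snds_cellTriple] at hv
  exact Subtype.ext (Prod.ext hx.symm (Prod.ext hy.symm (Prod.ext hw.symm hv.symm)))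

lemma isCompact_le_gauge_cellTriple {ε : ℝ} (hε : 0 < ε) :
    IsCompact {f | ε ≤ gauge (cellTriple f)} := by
  let C : Set Triple := {z | ε ≤ gauge z} ∩ {z | (z 0).1.1 = (z 1).1.1 ∧ (z 1).1.2 = (z 2).1.2 ∧
    (z 0).1.1 ≤ (z 2).1.1 ∧ (z 2).1.1 ≤ (z 0).1.2 ∧ (z 0).1.2 ≤ (z 2).1.2}
  have h1 : IsClosed {z : Triple | (z 0).1.1 = (z 1).1.1} :=
    isClosed_eq (by fun_prop) (by fun_prop)
  have h2 : IsClosed {z : Triple | (z 1).1.2 = (z 2).1.2} :=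
    isClosed_eq (by fun_prop) (by fun_prop)
  have h3 : IsClosed {z : Triple | (z 0).1.1 ≤ (z 2).1.1} :=
    isClosed_le (by fun_prop) (by fun_prop)
  have h4 : IsClosed {z : Triple | (z 2).1.1 ≤ (z 0).1.2} :=
    isClosed_le (by fun_prop) (by fun_prop)
  have h5 : IsClosed {z : Triple | (z 0).1.2 ≤ (z 2).1.2} :=
    isClosed_le (by fun_prop) (by fun_prop)
  have hC : IsCompact C :=
    (isCompact_le_gauge hε).inter_right (h1.inter (h2.inter (h3.inter (h4.inter h5))))
  let g : Triple → ℝ × ℝ × ℝ × ℝ := fun z => ((z 0).1.1, (z 2).1.1, (z 0).1.2, (z 2).1.2)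
  have hg : Continuous g := by fun_prop
  rw [Subtype.isCompact_iff]
  convert hC.image hg
  ext p
  constructor
  · rintro ⟨f, hf, rfl⟩
    exact ⟨cellTriple f, ⟨hf, rfl, rfl, f.2.1.le, f.2.2.1.le, f.2.2.2.le⟩, rfl⟩
  · rintro ⟨z, ⟨hz, h1, h2, h3, h4, h5⟩, rfl⟩
    obtain ⟨hinj, htri⟩ := gauge_pos_iff.1 (hε.trans_le hz)
    have hlt1 : (z 0).1.1 < (z 2).1.1 := h3.lt_of_ne fun h =>
      absurd (hinj (Subtype.ext (Prod.ext (h1 ▸ h) h2)) : (1 : Fin 3) = 2) (by decide)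
    have hlt2 : (z 2).1.1 < (z 0).1.2 := h4.lt_of_ne fun h =>
      htri 1 (tri_eq_zero.2 ⟨h1, h2, h.symm⟩)
    have hlt3 : (z 0).1.2 < (z 2).1.2 := h5.lt_of_ne fun h =>
      absurd (hinj (Subtype.ext (Prod.ext h1 (h.trans h2.symm))) : (0 : Fin 3) = 1) (by decide)
    refine ⟨⟨g z, hlt1, hlt2, hlt3⟩, ?_, rfl⟩
    have : cellTriple ⟨g z, hlt1, hlt2, hlt3⟩ = z := by
      funext i
      fin_cases i
      · rfl
      · exact Subtype.ext (Prod.ext h1 h2.symm)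
      · rfl
    rw [Set.mem_ofPred_eq, this]
    exact hz

/-- The inclusion of the compactified cell into the compactified configuration space. -/
def cellIncl : C(OnePoint Cell, OnePoint X) where
  toFun c := c.elim ∞ fun f => conf (cellTriple f)
  continuous_toFun := by
    refine (OnePoint.continuous_iff _).2 ⟨?_, continuous_conf.comp continuous_cellTriple⟩
    refine tendsto_infty (Metric.tendsto_nhds.2 fun ε hε => ?_)
    have hK := isCompact_le_gauge_cellTriple hε
    filter_upwards [hK.compl_mem_coclosedCompact_of_isClosed hK.isClosed] with f hf
    rw [Real.dist_eq, sub_zero, abs_of_nonneg (gaugeP_nonneg _), OnePoint.elim_some, gaugeP_conf]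
    exact not_le.1 hf

lemma cellIncl_coe (f : Cell) : cellIncl f = conf (cellTriple f) := rfl

lemma cellIncl_infty : cellIncl ∞ = ∞ := rfl

lemma cellIncl_injective : Function.Injective cellIncl := by
  have hne : ∀ f : Cell, cellIncl f ≠ ∞ := fun f h =>
    (gauge_cellTriple_pos f).ne' (conf_eq_infty.1 h)
  intro a b h
  induction a using OnePoint.rec with
  | infty =>
    induction b using OnePoint.rec with
    | infty => rfl
    | coe g => exact absurd h.symm (hne g)
  | coe f =>
    induction b using OnePoint.rec with
    | infty => exact absurd h (hne f)
    | coe g =>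
      rcases conf_eq_conf h with ⟨h0, -⟩ | ⟨σ, hσ⟩
      · exact absurd h0 (gauge_cellTriple_pos f).ne'
      · rw [cellTriple_eq_comp hσ]

lemma isClosedEmbedding_cellIncl : IsClosedEmbedding cellIncl :=
  cellIncl.continuous.isClosedEmbedding cellIncl_injective

/-- The cell is homeomorphic to a Euclidean space. -/
def cellHomeomorph : Cell ≃ₜ ℝ × ℝ × ℝ × ℝ where
  toFun f := (f.1.1, Real.log (f.1.2.1 - f.1.1), Real.log (f.1.2.2.1 - f.1.2.1),
    Real.log (f.1.2.2.2 - f.1.2.2.1))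
  invFun p := ⟨(p.1, p.1 + Real.exp p.2.1, p.1 + Real.exp p.2.1 + Real.exp p.2.2.1,
    p.1 + Real.exp p.2.1 + Real.exp p.2.2.1 + Real.exp p.2.2.2),
    lt_add_of_pos_right _ (Real.exp_pos _), lt_add_of_pos_right _ (Real.exp_pos _),
    lt_add_of_pos_right _ (Real.exp_pos _)⟩
  left_inv f := by
    obtain ⟨⟨x, y, w, v⟩, hxy, hyw, hwv⟩ := f
    refine Subtype.ext ?_
    simp only at hxy hyw hwv
    simp [Real.exp_log, hxy, hyw, hwv]
  right_inv p := by simp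
  continuous_toFun := by
    refine (by fun_prop : Continuous fun f : Cell => f.1.1).prodMk
      ((Continuous.log (by fun_prop) fun f => (sub_pos.2 f.2.1).ne').prodMk
        ((Continuous.log (by fun_prop) fun f => (sub_pos.2 f.2.2.1).ne').prodMk
          (Continuous.log (by fun_prop) fun f => (sub_pos.2 f.2.2.2).ne')))
  continuous_invFun := by fun_prop

/-- A deformation of the compactified configuration space into the compactified cell gives a
homotopy equivalence. -/
def homotopyEquivOfDeformation (k : C(OnePoint X × unitInterval, OnePoint X))
    (h0 : ∀ c, k (c, 0) = c) (h1 : ∀ c, k (c, 1) ∈ Set.range cellIncl)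
    (hfix : ∀ a, k (cellIncl a, 1) = cellIncl a) :
    ContinuousMap.HomotopyEquiv (OnePoint X) (OnePoint Cell) :=
  let r : C(OnePoint X, OnePoint Cell) :=
    ⟨fun c => isClosedEmbedding_cellIncl.isEmbedding.toHomeomorph.symm ⟨k (c, 1), h1 c⟩, by
      fun_prop⟩
  have hr : ∀ c, cellIncl (r c) = k (c, 1) := fun c => congrArg Subtype.val
    (isClosedEmbedding_cellIncl.isEmbedding.toHomeomorph.apply_symm_apply ⟨k (c, 1), h1 c⟩)
  { toFun := r
    invFun := cellIncl
    left_inv := ⟨ContinuousMap.Homotopy.symm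
      { toFun := fun p => k (p.2, p.1)
        map_zero_left := h0
        map_one_left := fun c => (hr c).symm }⟩
    right_inv := by
      have : r.comp cellIncl = ContinuousMap.id _ := by
        ext1 a
        exact cellIncl_injective ((hr _).trans (hfix a))
      rw [this] }

end TriConf

end

/-! ### The deformation onto the cell -/

noncomputable section

namespace TriConf

open Filter Topology OnePoint

/-- The continuous self-map of `[a, b]` that collapses the outer thirds to the end points. -/
def stretch (a b u : ℝ) : ℝ := max a (min b (3 * u - a - b))

/-- The linear homotopy from the identity to `stretch a b`. -/
def push (a b τ u : ℝ) : ℝ := u + τ * (stretch a b u - u)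

lemma abs_stretch_sub_le {a b u : ℝ} (ha : a ≤ u) (hb : u ≤ b) :
    |stretch a b u - u| ≤ min (u - a) (b - u) := by
  unfold stretch
  rw [abs_le, le_min_iff]
  rcases max_cases a (min b (3 * u - a - b)) with ⟨h, h'⟩ | ⟨h, h'⟩ <;>
  rcases min_cases b (3 * u - a - b) with ⟨g, g'⟩ | ⟨g, g'⟩ <;>
  rcases min_cases (u - a) (b - u) with ⟨k, k'⟩ | ⟨k, k'⟩ <;>
  rw [h, k] <;> (try rw [g]) <;> refine ⟨?_, ?_, ?_⟩ <;> linarith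

lemma abs_push_sub_le {a b τ u : ℝ} (hτ : 0 ≤ τ) (ha : a ≤ u) (hb : u ≤ b) :
    |push a b τ u - u| ≤ τ * min (u - a) (b - u) := by
  rw [push, add_sub_cancel_left, abs_mul, abs_of_nonneg hτ]
  exact mul_le_mul_of_nonneg_left (abs_stretch_sub_le ha hb) hτ

lemma push_zero (a b u : ℝ) : push a b 0 u = u := by simp [push]

lemma push_one (a b u : ℝ) : push a b 1 u = stretch a b u := by simp [push]

lemma push_of_min_eq_zero {a b τ u : ℝ} (hτ : 0 ≤ τ) (ha : a ≤ u) (hb : u ≤ b)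
    (h : min (u - a) (b - u) = 0) : push a b τ u = u := by
  have := abs_push_sub_le hτ ha hb
  rw [h, mul_zero] at this
  exact sub_eq_zero.1 (abs_nonpos_iff.1 this)

lemma push_left {a b τ : ℝ} (hτ : 0 ≤ τ) (hab : a ≤ b) : push a b τ a = a :=
  push_of_min_eq_zero hτ le_rfl hab (by rw [sub_self, min_eq_left (sub_nonneg.2 hab)])

lemma push_right {a b τ : ℝ} (hτ : 0 ≤ τ) (hab : a ≤ b) : push a b τ b = b :=
  push_of_min_eq_zero hτ hab le_rfl (by rw [sub_self, min_eq_right (sub_nonneg.2 hab)])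

lemma stretch_eq_left {a b u : ℝ} (h : u - a < (b - a) / 3) :
    stretch a b u = a := by
  rw [stretch, max_eq_left ((min_le_right _ _).trans (by linarith))]

lemma stretch_eq_right {a b u : ℝ} (hab : a ≤ b) (h : b - u < (b - a) / 3) :
    stretch a b u = b := by
  rw [stretch, min_eq_left (by linarith), max_eq_right hab]

lemma stretch_eq_or {a b u : ℝ} (hab : a ≤ b) (h : min (u - a) (b - u) < (b - a) / 3) :
    (stretch a b u = a ∧ u - a < (b - a) / 3) ∨ (stretch a b u = b ∧ b - u < (b - a) / 3) := by
  rcases min_lt_iff.1 h with h | h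
  · exact Or.inl ⟨stretch_eq_left h, h⟩
  · exact Or.inr ⟨stretch_eq_right hab h, h⟩

/-- The failure of the `i`-th point of a triple to be one of the corners `(x, w)`, `(x, v)`,
`(y, v)` of the bounding box `[x, y] × [w, v]`. -/
def cornerDefect (z : Triple) (i : Fin 3) : ℝ :=
  min (fsts z i - lo (fsts z)) (hi (fsts z) - fsts z i) +
    min (snds z i - lo (snds z)) (hi (snds z) - snds z i) +
    min (fsts z i - lo (fsts z)) (hi (snds z) - snds z i)

/-- The failure of a triple to lie in the closure of the cell. -/
def defect (z : Triple) : ℝ := ∑ i, cornerDefect z i + max (hi (fsts z) - lo (snds z)) 0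

/-- A third of the smaller side of the bounding box. -/
def margin (z : Triple) : ℝ := min (hi (fsts z) - lo (fsts z)) (hi (snds z) - lo (snds z)) / 3

/-- The deformation is at infinity where this quantity is not positive. -/
def slack (z : Triple) (τ : ℝ) : ℝ := margin z + defect z - 2 * τ * defect z

/-- The amount by which the points are lifted. -/
def lift (z : Triple) (τ : ℝ) : ℝ := 2 * (τ * defect z) + τ * defect z / max (slack z τ) 0

lemma fst_min_nonneg (z : Triple) (i : Fin 3) :
    0 ≤ min (fsts z i - lo (fsts z)) (hi (fsts z) - fsts z i) :=
  le_min (sub_nonneg.2 (lo_le _ i)) (sub_nonneg.2 (le_hi _ i))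

lemma snd_min_nonneg (z : Triple) (i : Fin 3) :
    0 ≤ min (snds z i - lo (snds z)) (hi (snds z) - snds z i) :=
  le_min (sub_nonneg.2 (lo_le _ i)) (sub_nonneg.2 (le_hi _ i))

lemma mixed_min_nonneg (z : Triple) (i : Fin 3) :
    0 ≤ min (fsts z i - lo (fsts z)) (hi (snds z) - snds z i) :=
  le_min (sub_nonneg.2 (lo_le _ i)) (sub_nonneg.2 (le_hi _ i))

lemma cornerDefect_nonneg (z : Triple) (i : Fin 3) : 0 ≤ cornerDefect z i :=
  add_nonneg (add_nonneg (fst_min_nonneg z i) (snd_min_nonneg z i)) (mixed_min_nonneg z i)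

lemma cornerDefect_le_defect (z : Triple) (i : Fin 3) : cornerDefect z i ≤ defect z :=
  (Finset.single_le_sum (fun j _ => cornerDefect_nonneg z j) (Finset.mem_univ i)).trans
    (le_add_of_nonneg_right (le_max_right _ _))

lemma fst_min_le_defect (z : Triple) (i : Fin 3) :
    min (fsts z i - lo (fsts z)) (hi (fsts z) - fsts z i) ≤ defect z := by
  have := cornerDefect_le_defect z i
  rw [cornerDefect] at this
  linarith [snd_min_nonneg z i, mixed_min_nonneg z i]

lemma snd_min_le_defect (z : Triple) (i : Fin 3) :
    min (snds z i - lo (snds z)) (hi (snds z) - snds z i) ≤ defect z := by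
  have := cornerDefect_le_defect z i
  rw [cornerDefect] at this
  linarith [fst_min_nonneg z i, mixed_min_nonneg z i]

lemma mixed_min_le_defect (z : Triple) (i : Fin 3) :
    min (fsts z i - lo (fsts z)) (hi (snds z) - snds z i) ≤ defect z := by
  have := cornerDefect_le_defect z i
  rw [cornerDefect] at this
  linarith [fst_min_nonneg z i, snd_min_nonneg z i]

lemma sub_le_defect (z : Triple) : hi (fsts z) - lo (snds z) ≤ defect z :=
  (le_max_left _ 0).trans
    (le_add_of_nonneg_left (Finset.sum_nonneg fun i _ => cornerDefect_nonneg z i))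

lemma defect_nonneg (z : Triple) : 0 ≤ defect z :=
  (cornerDefect_nonneg z 0).trans (cornerDefect_le_defect z 0)

lemma margin_nonneg (z : Triple) : 0 ≤ margin z :=
  div_nonneg (le_min (sub_nonneg.2 (lo_le_hi _)) (sub_nonneg.2 (lo_le_hi _))) (by norm_num)

lemma margin_le_fst (z : Triple) : margin z ≤ (hi (fsts z) - lo (fsts z)) / 3 :=
  div_le_div_of_nonneg_right (min_le_left _ _) (by norm_num)

lemma margin_le_snd (z : Triple) : margin z ≤ (hi (snds z) - lo (snds z)) / 3 :=
  div_le_div_of_nonneg_right (min_le_right _ _) (by norm_num)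

@[fun_prop]
lemma continuous_defect : Continuous defect := by
  unfold defect cornerDefect
  simp only [fsts, snds]
  fun_prop

@[fun_prop]
lemma continuous_margin : Continuous margin := by
  unfold margin
  fun_prop

lemma fsts_comp (z : Triple) (σ : Equiv.Perm (Fin 3)) : fsts (z ∘ σ) = fsts z ∘ σ := rfl

lemma snds_comp (z : Triple) (σ : Equiv.Perm (Fin 3)) : snds (z ∘ σ) = snds z ∘ σ := rfl

lemma defect_comp (z : Triple) (σ : Equiv.Perm (Fin 3)) : defect (z ∘ σ) = defect z := by
  have h : ∀ i, cornerDefect (z ∘ σ) i = cornerDefect z (σ i) := fun i => by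
    simp only [cornerDefect, fsts_comp, snds_comp, lo_comp, hi_comp, Function.comp_apply]
  simp only [defect, h, fsts_comp, snds_comp, lo_comp, hi_comp]
  rw [Equiv.sum_comp σ (cornerDefect z)]

lemma margin_comp (z : Triple) (σ : Equiv.Perm (Fin 3)) : margin (z ∘ σ) = margin z := by
  simp only [margin, fsts_comp, snds_comp, lo_comp, hi_comp]

lemma slack_comp (z : Triple) (σ : Equiv.Perm (Fin 3)) (τ : ℝ) : slack (z ∘ σ) τ = slack z τ := by
  rw [slack, margin_comp, defect_comp, slack]

lemma lift_comp (z : Triple) (σ : Equiv.Perm (Fin 3)) (τ : ℝ) : lift (z ∘ σ) τ = lift z τ := by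
  rw [lift, slack_comp, defect_comp, lift]

lemma two_mul_le_lift (z : Triple) {τ : ℝ} (hτ : 0 ≤ τ) : 2 * (τ * defect z) ≤ lift z τ :=
  le_add_of_nonneg_right
    (div_nonneg (mul_nonneg hτ (defect_nonneg z)) (le_max_right _ _))

lemma lift_nonneg (z : Triple) {τ : ℝ} (hτ : 0 ≤ τ) : 0 ≤ lift z τ :=
  (mul_nonneg zero_le_two (mul_nonneg hτ (defect_nonneg z))).trans (two_mul_le_lift z hτ)

lemma abs_push_fst_sub_le (z : Triple) {τ : ℝ} (hτ : 0 ≤ τ) (i : Fin 3) :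
    |push (lo (fsts z)) (hi (fsts z)) τ (fsts z i) - fsts z i| ≤ τ * defect z :=
  (abs_push_sub_le hτ (lo_le _ i) (le_hi _ i)).trans
    (mul_le_mul_of_nonneg_left (fst_min_le_defect z i) hτ)

lemma abs_push_snd_sub_le (z : Triple) {τ : ℝ} (hτ : 0 ≤ τ) (i : Fin 3) :
    |push (lo (snds z)) (hi (snds z)) τ (snds z i) - snds z i| ≤ τ * defect z :=
  (abs_push_sub_le hτ (lo_le _ i) (le_hi _ i)).trans
    (mul_le_mul_of_nonneg_left (snd_min_le_defect z i) hτ)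

/-- The deformation on the level of triples. -/
def deform (z : Triple) (τ : unitInterval) : Triple := fun i =>
  ⟨(push (lo (fsts z)) (hi (fsts z)) τ (fsts z i),
    push (lo (snds z)) (hi (snds z)) τ (snds z i) + lift z τ), by
    have h1 := (abs_le.1 (abs_push_fst_sub_le z τ.2.1 i)).2
    have h2 := (abs_le.1 (abs_push_snd_sub_le z τ.2.1 i)).1
    have h3 := two_mul_le_lift z τ.2.1
    have h4 : fsts z i ≤ snds z i := (z i).2
    simp only
    linarith⟩

lemma deform_comp (z : Triple) (σ : Equiv.Perm (Fin 3)) (τ : unitInterval) :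
    deform (z ∘ σ) τ = deform z τ ∘ σ := by
  funext i
  refine Subtype.ext (Prod.ext ?_ ?_)
  · simp only [deform, fsts_comp, lo_comp, hi_comp, Function.comp_apply]
  · simp only [deform, snds_comp, lo_comp, hi_comp, Function.comp_apply, lift_comp]

lemma deform_eq_deform {z : Triple} {i j : Fin 3} (h : z i = z j) (τ : unitInterval) :
    deform z τ i = deform z τ j := by
  have h1 : fsts z i = fsts z j := congrArg (fun p : Psi => p.1.1) h
  have h2 : snds z i = snds z j := congrArg (fun p : Psi => p.1.2) h
  refine Subtype.ext (Prod.ext ?_ ?_)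
  · simp only [deform, h1]
  · simp only [deform, h2]

lemma deform_of_defect_eq_zero {z : Triple} (h : defect z = 0) (τ : unitInterval) :
    deform z τ = z := by
  funext i
  have h1 := abs_push_fst_sub_le z τ.2.1 i
  have h2 := abs_push_snd_sub_le z τ.2.1 i
  rw [h, mul_zero, abs_nonpos_iff, sub_eq_zero] at h1 h2
  refine Subtype.ext (Prod.ext h1 ?_)
  simp only [deform, lift, h, mul_zero, zero_div, add_zero]
  exact h2

lemma deform_zero (z : Triple) : deform z 0 = z := by
  funext i
  refine Subtype.ext (Prod.ext ?_ ?_)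
  · simp [deform, push_zero, fsts]
  · simp [deform, push_zero, snds, lift]

lemma hi_snds_add_lift_le (z : Triple) (τ : unitInterval) :
    hi (snds z) + lift z τ ≤ extent (deform z τ) := by
  obtain ⟨i, h⟩ := exists_eq_hi (snds z)
  refine le_trans (le_of_eq ?_) ((le_hi (snds (deform z τ)) i).trans (le_max_right _ _))
  simp only [snds, deform]
  rw [show (z i).1.2 = hi (snds z) from h, push_right τ.2.1 (lo_le_hi _)]

lemma extent_le_extent_deform (z : Triple) (τ : unitInterval) :
    extent z ≤ extent (deform z τ) := by
  refine max_le (le_trans (neg_le_neg ?_) (le_max_left _ _)) ?_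
  · obtain ⟨i, h⟩ := exists_eq_lo (fsts z)
    refine (lo_le (fsts (deform z τ)) i).trans (le_of_eq ?_)
    simp only [fsts, deform]
    rw [show (z i).1.1 = lo (fsts z) from h, push_left τ.2.1 (lo_le_hi _)]
  · linarith [hi_snds_add_lift_le z τ, lift_nonneg z τ.2.1]

lemma sep_deform_le (z : Triple) (τ : unitInterval) (i j : Fin 3) :
    sep (deform z τ i) (deform z τ j) ≤ sep (z i) (z j) + 4 * defect z := by
  have hτ : (τ : ℝ) * defect z ≤ defect z := mul_le_of_le_one_left (defect_nonneg z) τ.2.2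
  have key : ∀ {a b c d e g : ℝ}, |a - c| ≤ g → |b - d| ≤ g → |a + e - (b + e)| ≤ |c - d| + 2 * g :=
    fun {a b c d e g} h1 h2 => by
      have h3 := abs_le.1 h1
      have h4 := abs_le.1 h2
      have h5 := abs_le.1 (le_refl |c - d|)
      rw [abs_le]
      constructor <;> linarith
  have h1 := key (e := 0) ((abs_push_fst_sub_le z τ.2.1 i).trans hτ)
    ((abs_push_fst_sub_le z τ.2.1 j).trans hτ)
  have h2 := key (e := lift z τ) ((abs_push_snd_sub_le z τ.2.1 i).trans hτ)
    ((abs_push_snd_sub_le z τ.2.1 j).trans hτ)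
  rw [add_zero, add_zero] at h1
  have h3 := add_le_add h1 h2
  calc _ ≤ _ := h3
    _ = _ := by simp only [sep, fsts, snds]; ring

lemma mem_corners_of_defect_eq_zero {z : Triple} (h : defect z = 0) (i : Fin 3) :
    (fsts z i = lo (fsts z) ∨ fsts z i = hi (fsts z)) ∧
      (snds z i = lo (snds z) ∨ snds z i = hi (snds z)) := by
  have h1 := fst_min_le_defect z i
  have h2 := snd_min_le_defect z i
  rw [h, min_le_iff, sub_nonpos, sub_nonpos] at h1 h2
  exact ⟨h1.imp (fun h => le_antisymm h (lo_le _ i)) fun h => le_antisymm (le_hi _ i) h,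
    h2.imp (fun h => le_antisymm h (lo_le _ i)) fun h => le_antisymm (le_hi _ i) h⟩

lemma exists_ne_eq_of_forall_or {u : Fin 3 → ℝ} {a b : ℝ} (h : ∀ i, u i = a ∨ u i = b) :
    ∃ i j, i ≠ j ∧ u i = u j := by
  rcases h 0 with h0 | h0 <;> rcases h 1 with h1 | h1 <;> rcases h 2 with h2 | h2
  all_goals first
    | exact ⟨0, 1, by decide, h0.trans h1.symm⟩
    | exact ⟨0, 2, by decide, h0.trans h2.symm⟩
    | exact ⟨1, 2, by decide, h1.trans h2.symm⟩

/-- A triple without defect and with degenerate bounding box has a double point. -/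
lemma exists_eq_of_defect_eq_zero {z : Triple} (h : defect z = 0) (h' : margin z = 0) :
    ∃ i j, i ≠ j ∧ z i = z j := by
  have hm : min (hi (fsts z) - lo (fsts z)) (hi (snds z) - lo (snds z)) ≤ 0 := by
    rw [margin] at h'
    linarith
  rcases min_le_iff.1 hm with hm | hm
  · obtain ⟨i, j, hij, e⟩ :=
      exists_ne_eq_of_forall_or fun i => (mem_corners_of_defect_eq_zero h i).2
    refine ⟨i, j, hij, Subtype.ext (Prod.ext ?_ e)⟩
    change fsts z i = fsts z j
    linarith [lo_le (fsts z) i, le_hi (fsts z) i, lo_le (fsts z) j, le_hi (fsts z) j]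
  · obtain ⟨i, j, hij, e⟩ :=
      exists_ne_eq_of_forall_or fun i => (mem_corners_of_defect_eq_zero h i).1
    refine ⟨i, j, hij, Subtype.ext (Prod.ext e ?_)⟩
    change snds z i = snds z j
    linarith [lo_le (snds z) i, le_hi (snds z) i, lo_le (snds z) j, le_hi (snds z) j]

lemma gauge_eq_zero_of_eq {z : Triple} {i j : Fin 3} (hij : i ≠ j) (h : z i = z j) :
    gauge z = 0 :=
  le_antisymm ((gauge_le_sep z hij).trans (sep_eq_zero.2 h).le) (gauge_nonneg z)

/-- The triples in the closure of the cell have no defect. -/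
lemma defect_eq_zero {z : Triple} (h1 : (z 0).1.1 = (z 1).1.1) (h2 : (z 1).1.2 = (z 2).1.2)
    (h3 : (z 0).1.1 ≤ (z 2).1.1) (h4 : (z 2).1.1 ≤ (z 0).1.2) (h5 : (z 0).1.2 ≤ (z 2).1.2) :
    defect z = 0 := by
  have hx : lo (fsts z) = (z 0).1.1 :=
    lo_eq (fun i => by fin_cases i <;> simp [fsts, h3, ← h1]) 0 rfl
  have hy : hi (fsts z) = (z 2).1.1 :=
    hi_eq (fun i => by fin_cases i <;> simp [fsts, ← h1, h3]) 2 rfl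
  have hw : lo (snds z) = (z 0).1.2 :=
    lo_eq (fun i => by fin_cases i <;> simp [snds, h2, h5]) 0 rfl
  have hv : hi (snds z) = (z 2).1.2 :=
    hi_eq (fun i => by fin_cases i <;> simp [snds, h2, h5]) 2 rfl
  rw [defect, Fin.sum_univ_three]
  simp only [cornerDefect, hx, hy, hw, hv, fsts, snds, ← h1, h2, sub_self]
  simp [h3, h4, h5]

lemma defect_eq_zero_of_tri {z : Triple} {σ : Equiv.Perm (Fin 3)}
    (h : tri (z (σ 0)) (z (σ 1)) (z (σ 2)) = 0) : defect z = 0 := by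
  obtain ⟨h1, h2, h3⟩ := tri_eq_zero.1 h
  rw [← defect_comp z σ]
  have h4 := (z (σ 0)).2
  have h5 := (z (σ 2)).2
  exact defect_eq_zero h1 h2 (by simpa [← h3] using h4) h3.ge (by simpa [h3] using h5)

open Classical in
/-- The deformation as a map to the compactified configuration space. -/
def deformConf (p : Triple × unitInterval) : OnePoint X :=
  if 0 < slack p.1 p.2 then conf (deform p.1 p.2) else ∞

lemma deformConf_of_pos {p : Triple × unitInterval} (h : 0 < slack p.1 p.2) :
    deformConf p = conf (deform p.1 p.2) := if_pos h

lemma deformConf_of_nonpos {p : Triple × unitInterval} (h : slack p.1 p.2 ≤ 0) :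
    deformConf p = ∞ := if_neg h.not_gt

lemma gaugeP_deformConf_le (p : Triple × unitInterval) :
    gaugeP (deformConf p) ≤ gauge (deform p.1 p.2) := by
  rcases lt_or_ge 0 (slack p.1 p.2) with h | h
  · rw [deformConf_of_pos h, gaugeP_conf]
  · rw [deformConf_of_nonpos h, gaugeP_infty]
    exact gauge_nonneg _

lemma gaugeP_deformConf_le_inv (z : Triple) (τ : unitInterval) :
    gaugeP (deformConf (z, τ)) ≤ 1 / (1 + extent z) :=
  ((gaugeP_deformConf_le _).trans (gauge_le_inv _)).trans
    (one_div_le_one_div_of_le (by linarith [extent_nonneg z])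
      (by linarith [extent_le_extent_deform z τ]))

lemma deformConf_comp (z : Triple) (σ : Equiv.Perm (Fin 3)) (τ : unitInterval) :
    deformConf (z ∘ σ, τ) = deformConf (z, τ) := by
  simp only [deformConf, slack_comp, deform_comp, conf_comp]

lemma deformConf_of_defect_eq_zero {z : Triple} (h : defect z = 0) (τ : unitInterval) :
    deformConf (z, τ) = conf z := by
  rcases lt_or_ge 0 (slack z τ) with hs | hs
  · rw [deformConf_of_pos (p := (z, τ)) hs, deform_of_defect_eq_zero h]
  · rw [deformConf_of_nonpos (p := (z, τ)) hs]
    have hm : margin z = 0 := le_antisymm (by simpa [slack, h] using hs) (margin_nonneg z)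
    obtain ⟨i, j, hij, e⟩ := exists_eq_of_defect_eq_zero h hm
    exact (conf_of_eq_zero (gauge_eq_zero_of_eq hij e)).symm

lemma deformConf_of_gauge_eq_zero (z : Triple) (τ : unitInterval) (h : gauge z = 0) :
    deformConf (z, τ) = ∞ := by
  have h' := mt gauge_pos_iff.2 h.not_gt
  rw [not_and_or, not_forall] at h'
  rcases h' with h' | ⟨σ, hσ⟩
  · simp only [Function.Injective, not_forall] at h'
    obtain ⟨i, j, e, hij⟩ := h'
    refine gaugeP_eq_zero.1 (le_antisymm ?_ (gaugeP_nonneg _))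
    exact (gaugeP_deformConf_le _).trans (gauge_eq_zero_of_eq hij (deform_eq_deform e τ)).le
  · rw [deformConf_of_defect_eq_zero (defect_eq_zero_of_tri (not_not.1 hσ)), conf_of_eq_zero h]

lemma deformConf_zero (z : Triple) : deformConf (z, 0) = conf z := by
  rcases lt_or_ge 0 (slack z (0 : unitInterval)) with hs | hs
  · rw [deformConf_of_pos (p := (z, 0)) hs, deform_zero]
  · refine deformConf_of_defect_eq_zero (le_antisymm ?_ (defect_nonneg z)) 0
    simp only [slack, Set.Icc.coe_zero] at hs
    linarith [margin_nonneg z]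

/-- The estimate that makes the deformation continuous where it reaches infinity. -/
lemma gaugeP_deformConf_mul_le (p : Triple × unitInterval) :
    gaugeP (deformConf p) * (p.2 * defect p.1) ≤ (1 + |hi (snds p.1)|) * max (slack p.1 p.2) 0 := by
  rcases lt_or_ge 0 (slack p.1 p.2) with hs | hs
  · rw [deformConf_of_pos hs, gaugeP_conf, max_eq_left hs.le]
    set h := gauge (deform p.1 p.2)
    set e := (p.2 : ℝ) * defect p.1 with he
    have he0 : 0 ≤ e := mul_nonneg p.2.2.1 (defect_nonneg _)
    have h0 : 0 ≤ h := gauge_nonneg _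
    have hext := extent_nonneg (deform p.1 p.2)
    have h1 : h * (1 + extent (deform p.1 p.2)) ≤ 1 :=
      (le_div_iff₀ (by linarith)).1 (gauge_le_inv _)
    have h2 : h ≤ 1 := by nlinarith
    have h3 : hi (snds p.1) + e / slack p.1 p.2 ≤ extent (deform p.1 p.2) := by
      refine le_trans ?_ (hi_snds_add_lift_le p.1 p.2)
      rw [lift, max_eq_left hs.le]
      linarith
    have h4 : h * (e / slack p.1 p.2) ≤ 1 + |hi (snds p.1)| := by
      have h5 := mul_le_mul_of_nonneg_left h3 h0
      have h6 : h * |hi (snds p.1)| ≤ |hi (snds p.1)| := mul_le_of_le_one_left (abs_nonneg _) h2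
      have h7 := mul_le_mul_of_nonneg_left (neg_abs_le (hi (snds p.1))) h0
      linarith
    rwa [← mul_div_assoc, div_le_iff₀ hs] at h4
  · rw [deformConf_of_nonpos hs, gaugeP_infty, zero_mul]
    positivity

lemma continuous_slack : Continuous fun p : Triple × unitInterval => slack p.1 p.2 := by
  unfold slack
  fun_prop

lemma continuousAt_deform {p : Triple × unitInterval} (h : 0 < slack p.1 p.2) :
    ContinuousAt (fun p : Triple × unitInterval => deform p.1 p.2) p := by
  have hl : ContinuousAt (fun p : Triple × unitInterval => lift p.1 p.2) p := by
    unfold lift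
    refine ContinuousAt.add (by fun_prop) (ContinuousAt.div (by fun_prop)
      (continuous_slack.max continuous_const).continuousAt ?_)
    exact (lt_max_of_lt_left h).ne'
  refine continuousAt_pi.2 fun i => Topology.IsInducing.subtypeVal.continuousAt_iff.2 ?_
  refine ContinuousAt.prodMk ?_ (ContinuousAt.add ?_ hl)
  · simp only [push, stretch, fsts]
    fun_prop
  · simp only [push, stretch, snds]
    fun_prop

lemma continuous_deformConf : Continuous deformConf := by
  refine continuous_iff_continuousAt.2 fun p => ?_
  rcases lt_or_ge 0 (slack p.1 p.2) with hs | hs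
  · refine (continuous_conf.continuousAt.comp (continuousAt_deform hs)).congr ?_
    filter_upwards [continuous_slack.continuousAt.eventually (lt_mem_nhds hs)] with q hq
    exact (deformConf_of_pos hq).symm
  · rw [ContinuousAt, deformConf_of_nonpos hs]
    refine tendsto_infty ?_
    rcases (defect_nonneg p.1).eq_or_lt with he | he
    · have hm : margin p.1 = 0 :=
        le_antisymm (by simpa [slack, ← he] using hs) (margin_nonneg _)
      obtain ⟨i, j, hij, e⟩ := exists_eq_of_defect_eq_zero he.symm hm
      have hc : Continuous fun q : Triple × unitInterval =>
          sep (q.1 i) (q.1 j) + 4 * defect q.1 := by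
        unfold sep
        fun_prop
      have hlim := hc.tendsto p
      rw [sep_eq_zero.2 e, ← he, mul_zero, add_zero] at hlim
      exact squeeze_zero (fun _ => gaugeP_nonneg _) (fun q => (gaugeP_deformConf_le q).trans
        ((gauge_le_sep _ hij).trans (sep_deform_le q.1 q.2 i j))) hlim
    · have hτ : 0 < (p.2 : ℝ) * defect p.1 := by
        have := margin_nonneg p.1
        unfold slack at hs
        linarith
      have hc : Continuous fun q : Triple × unitInterval => (q.2 : ℝ) * defect q.1 := by fun_prop
      have hlim : Tendsto (fun q : Triple × unitInterval =>
          (1 + |hi (snds q.1)|) * max (slack q.1 q.2) 0 / (q.2 * defect q.1)) (𝓝 p) (𝓝 0) := by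
        have hcA : ContinuousAt (fun q : Triple × unitInterval =>
            (1 + |hi (snds q.1)|) * max (slack q.1 q.2) 0 / (q.2 * defect q.1)) p :=
          ContinuousAt.div (Continuous.continuousAt <| by
            have := continuous_slack
            fun_prop) hc.continuousAt hτ.ne'
        have := hcA.tendsto
        rwa [max_eq_right hs, mul_zero, zero_div] at this
      refine squeeze_zero' (Eventually.of_forall fun _ => gaugeP_nonneg _) ?_ hlim
      filter_upwards [hc.continuousAt.eventually (lt_mem_nhds hτ)] with q hq
      exact (le_div_iff₀ hq).2 (gaugeP_deformConf_mul_le q)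

lemma deform_one_mem_corners {z : Triple} (h : 0 < slack z 1) (i : Fin 3) :
    ((deform z 1 i).1 = (lo (fsts z), lo (snds z) + lift z 1)) ∨
    ((deform z 1 i).1 = (lo (fsts z), hi (snds z) + lift z 1)) ∨
    ((deform z 1 i).1 = (hi (fsts z), hi (snds z) + lift z 1)) := by
  have hlt : defect z < margin z := by
    unfold slack at h
    linarith
  have h1 := margin_le_fst z
  have h2 := margin_le_snd z
  have hd : (deform z 1 i).1 = (stretch (lo (fsts z)) (hi (fsts z)) (fsts z i),
      stretch (lo (snds z)) (hi (snds z)) (snds z i) + lift z 1) := by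
    simp only [deform, Set.Icc.coe_one, push_one]
  rw [hd]
  rcases stretch_eq_or (lo_le_hi _) ((fst_min_le_defect z i).trans_lt (hlt.trans_le h1)) with
    ⟨e1, -⟩ | ⟨e1, g1⟩ <;>
  rcases stretch_eq_or (lo_le_hi _) ((snd_min_le_defect z i).trans_lt (hlt.trans_le h2)) with
    ⟨e2, g2⟩ | ⟨e2, -⟩ <;> rw [e1, e2]
  · simp
  · simp
  · have := (mixed_min_le_defect z i).trans_lt hlt
    rcases min_lt_iff.1 this with h3 | h3 <;>
      linarith [lo_le_hi (fsts z), lo_le_hi (snds z)]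
  · simp

lemma deformConf_one_mem (z : Triple) : deformConf (z, 1) ∈ Set.range cellIncl := by
  by_cases hinf : deformConf (z, 1) = ∞
  · exact ⟨∞, hinf.symm⟩
  have hs : 0 < slack z 1 := by
    by_contra h
    exact hinf (deformConf_of_nonpos (by simpa using h))
  have hK : deformConf (z, 1) = conf (deform z 1) := deformConf_of_pos (by simpa using hs)
  have hg : 0 < gauge (deform z 1) :=
    (gauge_nonneg _).lt_of_ne fun h => hinf (hK.trans (conf_of_eq_zero h.symm))
  obtain ⟨hinj, htri⟩ := gauge_pos_iff.1 hg
  have hlt : defect z < margin z := by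
    unfold slack at hs
    linarith
  have hpos := (defect_nonneg z).trans_lt hlt
  have hxy : lo (fsts z) < hi (fsts z) := by linarith [margin_le_fst z]
  have hwv : lo (snds z) < hi (snds z) := by linarith [margin_le_snd z]
  have hcor : ∀ i, ∃ j : Fin 3, (deform z 1 i).1 = ![(lo (fsts z), lo (snds z) + lift z 1),
      (lo (fsts z), hi (snds z) + lift z 1), (hi (fsts z), hi (snds z) + lift z 1)] j := fun i => by
    rcases deform_one_mem_corners hs i with h | h | h
    exacts [⟨0, h⟩, ⟨1, h⟩, ⟨2, h⟩]
  choose s hsc using hcor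
  have hsinj : Function.Injective s := fun i j hij =>
    hinj (Subtype.ext (by rw [hsc, hsc, hij]))
  let σ : Equiv.Perm (Fin 3) := Equiv.ofBijective s (Finite.injective_iff_bijective.1 hsinj)
  have hσ : ∀ j, (deform z 1 (σ.symm j)).1 = ![(lo (fsts z), lo (snds z) + lift z 1),
      (lo (fsts z), hi (snds z) + lift z 1), (hi (fsts z), hi (snds z) + lift z 1)] j := fun j => by
    rw [hsc]
    exact congrArg _ (σ.apply_symm_apply j)
  have hyw : hi (fsts z) < lo (snds z) + lift z 1 := by
    refine lt_of_le_of_ne ?_ fun h => htri σ.symm (tri_eq_zero.2 ?_)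
    · have := two_mul_le_lift z zero_le_one
      linarith [sub_le_defect z, defect_nonneg z]
    · simp [hσ, h]
  refine ⟨((⟨(lo (fsts z), hi (fsts z), lo (snds z) + lift z 1, hi (snds z) + lift z 1),
    hxy, hyw, by simpa using hwv⟩ : Cell) : OnePoint Cell), ?_⟩
  rw [cellIncl_coe, hK, ← conf_comp (deform z 1) σ.symm]
  congr 1
  funext j
  refine Subtype.ext ((hσ j).trans ?_).symm
  fin_cases j <;> rfl

/-- The compactified configuration space deforms into the compactified cell. -/
theorem nonempty_homotopyEquiv :
    Nonempty (ContinuousMap.HomotopyEquiv (OnePoint X) (OnePoint Cell)) := by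
  obtain ⟨k, hk⟩ := exists_descent deformConf continuous_deformConf deformConf_comp
    deformConf_of_gauge_eq_zero gaugeP_deformConf_le_inv
  refine ⟨homotopyEquivOfDeformation k (fun c => ?_) (fun c => ?_) fun a => ?_⟩
  · obtain ⟨z, rfl⟩ := conf_surjective c
    rw [hk, deformConf_zero]
  · obtain ⟨z, rfl⟩ := conf_surjective c
    rw [hk]
    exact deformConf_one_mem z
  · induction a using OnePoint.rec with
    | infty =>
      obtain ⟨z, hz⟩ := conf_surjective ∞
      rw [cellIncl_infty, ← hz, hk, deformConf_of_gauge_eq_zero z 1 (conf_eq_infty.1 hz), hz]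
    | coe f =>
      rw [cellIncl_coe, hk]
      exact deformConf_of_defect_eq_zero
        (defect_eq_zero rfl rfl f.2.1.le f.2.2.1.le f.2.2.2.le) 1

end TriConf

end

theorem TriConf.isSphereLike : RC.IsSphereLike (OnePoint TriConf.X) 5 := by
  obtain ⟨e⟩ := TriConf.nonempty_homotopyEquiv
  exact (isSphereLike_onePoint (ℝ × ℝ × ℝ × ℝ) (by simp)).of_homotopyEquiv
    (TriConf.cellHomeomorph.onePointCongr.symm.toHomotopyEquiv.trans e.symm)

/-- The reduced singular homology with `ℤ` coefficients of
the one-point compactification of `B(Ψ,3) ∖ T` is isomorphic to `ℤ` in degree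
`4` and vanishes in every other degree. -/
theorem reduced_homology_config_minus_triangles :
    (∀ i : ℕ, i ≠ 4 →
      Subsingleton (RedHomology (OnePoint {c : Config Psi 3 // c ∉ TriSet}) i)) ∧
    Nonempty (RedHomology (OnePoint {c : Config Psi 3 // c ∉ TriSet}) 4 ≃ₗ[ℤ] ℤ) := by
  obtain ⟨⟨e⟩, h⟩ := TriConf.isSphereLike
  refine ⟨fun i hi => h (i + 1) (by omega), ⟨?_⟩⟩
  let e' : RedHomology (OnePoint {c : Config Psi 3 // c ∉ TriSet}) 4 ≃+ ℤ := e
  exact { e' with map_smul' := fun n x => (map_zsmul e' n x) }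
end

section
/- The subspaces Δ and B(E,2) of B(Ψ,2) are homeomorphic; moreover, there exist a homeomorphism h : Δ → B(E,2) and a proper continuous map F : Δ × [0,1] → B(Ψ,2) such that F(·,0) is the inclusion Δ ↪ B(Ψ,2) and F(·,1) is the composition of h with the inclusion B(E,2) ↪ B(Ψ,2). -/
set_option autoImplicit false

/-!
Statement 14: The subspaces Δ and B(E,2) of B(Ψ,2) (Ψ the symmetric square of
the circle, E the equator) are homeomorphic, via a homeomorphism h which is
properly homotopic to the inclusion Δ ↪ B(Ψ,2).
-/

noncomputable section

/-- The symmetric square: the quotient of `X × X` by the swap. -/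
def symSetoid (X : Type) : Setoid (X × X) where
  r p q := q = p ∨ q = Prod.swap p
  iseqv := by
    constructor
    · exact fun p => Or.inl rfl
    · rintro p q (rfl | rfl)
      · exact Or.inl rfl
      · right; simp
    · rintro p q r (rfl | rfl) (rfl | rfl) <;> simp

/-- The symmetric square `Ψ` of the circle `𝕋`: unordered pairs `{x, y}` of
points of `𝕋` (with `x = y` allowed), with the quotient topology.  It is
homeomorphic to the closed Möbius band. -/
abbrev SymSq : Type := Quotient (symSetoid Circle)

/-- The unordered pair `{x, y}` as a point of `Ψ`. -/
def mkSym (p : Circle × Circle) : SymSq := Quotient.mk (symSetoid Circle) p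

/-- The point `−z` of the circle, antipodal to `z`. -/
def antipode (z : Circle) : Circle := Circle.exp Real.pi * z

/-- The equator `E = {{z, −z}} ⊂ Ψ`. -/
def equator : Set SymSq := {c | ∃ z : Circle, c = mkSym (z, antipode z)}

/-- The subspace `B(E,2) ⊆ B(Ψ,2)` of 2-element subsets of the equator. -/
def BE2 : Set (Config SymSq 2) :=
  {c | ∃ f : InjTuple SymSq 2, c = Quotient.mk (configSetoid SymSq 2) f ∧
    ∀ i : Fin 2, f.1 i ∈ equator}

/-- The subspace `Δ ⊆ B(Ψ,2)` of all configurations `{{α,β}, {α,γ}}` with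
`β ≠ γ` and `αβγ = 1` (the two points `{α,β}` and `{α,γ}` of `Ψ` being
distinct). -/
def DeltaSet : Set (Config SymSq 2) :=
  {c | ∃ α β γ : Circle, β ≠ γ ∧ α * β * γ = 1 ∧
    ∃ f : InjTuple SymSq 2, c = Quotient.mk (configSetoid SymSq 2) f ∧
      f.1 0 = mkSym (α, β) ∧ f.1 1 = mkSym (α, γ)}

open Topology

/-! ### The symmetric square as a subspace of `ℂ × ℂ` -/

/-- The elementary symmetric functions `(x + y, x * y)` of an unordered pair `{x, y}`. -/
def symFun : SymSq → ℂ × ℂ :=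
  Quotient.lift (s := symSetoid Circle)
    (fun p => ((p.1 : ℂ) + p.2, (p.1 : ℂ) * p.2)) (by
      rintro p q (rfl | rfl)
      · rfl
      · simp [add_comm, mul_comm])

@[simp]
lemma symFun_mkSym (x y : Circle) :
    symFun (mkSym (x, y)) = ((x : ℂ) + y, (x : ℂ) * y) := rfl

lemma mkSym_surjective (c : SymSq) : ∃ x y : Circle, c = mkSym (x, y) := by
  induction c using Quotient.inductionOn with
  | h p => exact ⟨p.1, p.2, rfl⟩

lemma symFun_injective : Function.Injective symFun := by
  intro a b h
  obtain ⟨x, y, rfl⟩ := mkSym_surjective a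
  obtain ⟨u, v, rfl⟩ := mkSym_surjective b
  simp only [symFun_mkSym, Prod.mk.injEq] at h
  obtain ⟨hs, hp⟩ := h
  have key : ((x : ℂ) - u) * ((x : ℂ) - v) = 0 := by
    linear_combination (x : ℂ) * hs - hp
  rcases mul_eq_zero.1 key with h | h
  · obtain rfl : x = u := Circle.ext (sub_eq_zero.1 h)
    obtain rfl : y = v := Circle.ext (add_left_cancel hs)
    rfl
  · obtain rfl : x = v := Circle.ext (sub_eq_zero.1 h)
    obtain rfl : y = u := Circle.ext (by linear_combination hs)
    exact Quotient.sound (s := symSetoid Circle) (Or.inr rfl)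

lemma continuous_symFun : Continuous symFun :=
  Continuous.quotient_lift (by fun_prop) _

instance : T2Space SymSq := T2Space.of_injective_continuous symFun_injective continuous_symFun

lemma isClosedEmbedding_symFun : IsClosedEmbedding symFun :=
  continuous_symFun.isClosedEmbedding symFun_injective

/-- The antipode of `z` is `-z` in `ℂ`. -/
lemma coe_antipode (z : Circle) : (antipode z : ℂ) = -z := by
  simp [antipode]

/-- The equator is the set of pairs with vanishing sum. -/
lemma mem_equator_iff (c : SymSq) : c ∈ equator ↔ (symFun c).1 = 0 := by
  constructor
  · rintro ⟨z, rfl⟩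
    simp [coe_antipode]
  · intro h
    obtain ⟨x, y, rfl⟩ := mkSym_surjective c
    obtain rfl : y = antipode x := by
      apply Circle.ext
      rw [coe_antipode]
      simp only [symFun_mkSym] at h
      linear_combination h
    exact ⟨x, rfl⟩

/-! ### The retraction onto the equator -/

lemma exists_circle_sq_eq (p : Circle) : ∃ w : Circle, w * w = p := by
  obtain ⟨θ, rfl⟩ := Circle.exp_surjective p
  exact ⟨Circle.exp (θ / 2), by rw [← Circle.exp_add]; simp⟩

/-- Scaling the sum of a pair by a factor in `[0,1]` while keeping its product gives a pair
of points of the circle again. -/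
lemma exists_symFun_eq (x y : Circle) (t : unitInterval) :
    ∃ c : SymSq, symFun c = ((1 - (t : ℝ) : ℂ) * ((x : ℂ) + y), (x : ℂ) * y) := by
  obtain ⟨w, hw⟩ := exists_circle_sq_eq (x * y)
  obtain ⟨u, rfl⟩ : ∃ u, x = w * u := ⟨w⁻¹ * x, by simp⟩
  obtain rfl : y = w * u⁻¹ := by
    have : w * (w * u⁻¹) = w * y := by
      rw [← mul_assoc, hw]
      simp [mul_assoc, mul_comm]
    exact (mul_left_cancel this).symm
  have hre : |(1 - (t : ℝ)) * (u : ℂ).re| ≤ 1 := by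
    have h1 := Complex.abs_re_le_norm (u : ℂ)
    rw [Circle.norm_coe] at h1
    rw [abs_mul, abs_of_nonneg (sub_nonneg.2 t.2.2)]
    nlinarith [t.2.1, t.2.2, abs_nonneg (u : ℂ).re]
  obtain ⟨h1, h2⟩ := abs_le.1 hre
  set θ := Real.arccos ((1 - (t : ℝ)) * (u : ℂ).re)
  have hcos : Real.cos θ = (1 - (t : ℝ)) * (u : ℂ).re := Real.cos_arccos h1 h2
  refine ⟨mkSym (w * Circle.exp θ, w * (Circle.exp θ)⁻¹), ?_⟩
  have hsum (v : Circle) : ((v : ℂ) + ((v⁻¹ : Circle) : ℂ)) = 2 * ((v : ℂ).re : ℂ) := by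
    rw [Circle.coe_inv_eq_conj, Complex.add_conj]
    push_cast
    ring
  have hexp : ((Circle.exp θ : Circle) : ℂ).re = Real.cos θ := by
    rw [Circle.coe_exp, Complex.exp_ofReal_mul_I_re]
  have hmul (v : Circle) : (v : ℂ) * ((v⁻¹ : Circle) : ℂ) = 1 := by
    rw [← Circle.coe_mul]; simp
  simp only [symFun_mkSym, Circle.coe_mul, Prod.mk.injEq]
  constructor
  · have e1 := hsum (Circle.exp θ)
    rw [hexp, hcos] at e1
    simp only [Complex.ofReal_mul, Complex.ofReal_sub, Complex.ofReal_one] at e1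
    linear_combination (w : ℂ) * e1 - (1 - (t : ℝ) : ℂ) * (w : ℂ) * hsum u
  · linear_combination (w : ℂ) * w * (hmul (Circle.exp θ) - hmul u)

/-- The path from `{x, y}` to the equator which scales the sum and keeps the product. -/
def retract (x y : Circle) (t : unitInterval) : SymSq := (exists_symFun_eq x y t).choose

@[simp]
lemma symFun_retract (x y : Circle) (t : unitInterval) :
    symFun (retract x y t) = ((1 - (t : ℝ) : ℂ) * ((x : ℂ) + y), (x : ℂ) * y) :=
  (exists_symFun_eq x y t).choose_spec

lemma retract_zero (x y : Circle) : retract x y 0 = mkSym (x, y) :=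
  symFun_injective (by simp)

lemma retract_one_mem_equator (x y : Circle) : retract x y 1 ∈ equator := by
  simp [mem_equator_iff]

lemma continuous_retract :
    Continuous fun q : Circle × Circle × unitInterval => retract q.1 q.2.1 q.2.2 := by
  rw [isClosedEmbedding_symFun.isEmbedding.continuous_iff]
  simp only [Function.comp_def, symFun_retract]
  fun_prop

/-! ### The projection to the configuration space -/

section Projection

variable {X : Type} {k : ℕ}

/-- The projection from injective tuples to the configuration space is proper. -/
lemma isProperMap_configMk [TopologicalSpace X] :
    IsProperMap (Quotient.mk (configSetoid X k) : InjTuple X k → Config X k) := by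
  have hfib (f g : InjTuple X k) : Quotient.mk (configSetoid X k) f =
      Quotient.mk (configSetoid X k) g ↔ ∃ σ : Equiv.Perm (Fin k), f.1 = g.1 ∘ σ :=
    ⟨fun h => Quotient.exact h, fun h => Quotient.sound (s := configSetoid X k) h⟩
  let act (σ : Equiv.Perm (Fin k)) (f : InjTuple X k) : InjTuple X k :=
    ⟨f.1 ∘ σ, f.2.comp σ.injective⟩
  have hact (σ : Equiv.Perm (Fin k)) : Continuous (act σ) := by
    refine Continuous.subtype_mk (continuous_pi fun i => ?_) _
    exact (continuous_apply (σ i)).comp continuous_subtype_val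
  rw [isProperMap_iff_isClosedMap_and_compact_fibers]
  refine ⟨continuous_quotient_mk', fun C hC => ?_, fun c => ?_⟩
  · rw [← isQuotientMap_quotient_mk'.isClosed_preimage]
    have : Quotient.mk (configSetoid X k) ⁻¹' (Quotient.mk (configSetoid X k) '' C) =
        ⋃ σ, act σ ⁻¹' C := by
      ext f
      simp only [Set.mem_preimage, Set.mem_image, Set.mem_iUnion, hfib]
      constructor
      · rintro ⟨g, hg, σ, hσ⟩
        refine ⟨σ, ?_⟩
        rwa [show act σ f = g from Subtype.ext hσ.symm]
      · rintro ⟨σ, hσ⟩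
        exact ⟨_, hσ, σ, rfl⟩
    exact this ▸ isClosed_iUnion_of_finite fun σ => hC.preimage (hact σ)
  · obtain ⟨f, rfl⟩ := Quotient.exists_rep c
    refine Set.Finite.isCompact ((Set.finite_range fun σ => act σ f).subset ?_)
    intro g hg
    obtain ⟨σ, hσ⟩ := (hfib g f).1 hg
    exact ⟨σ, Subtype.ext hσ.symm⟩

lemma configMk_two_eq_iff (f g : InjTuple X 2) :
    Quotient.mk (configSetoid X 2) f = Quotient.mk (configSetoid X 2) g ↔
      (f.1 0 = g.1 0 ∧ f.1 1 = g.1 1) ∨ (f.1 0 = g.1 1 ∧ f.1 1 = g.1 0) := by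
  constructor
  · intro h
    obtain ⟨σ, hσ⟩ := Quotient.exact h
    have h0 := congrFun hσ 0
    have h1 := congrFun hσ 1
    have hne : σ 0 ≠ σ 1 := fun h => absurd (σ.injective h) (by decide)
    simp only [Function.comp_apply] at h0 h1
    generalize σ 0 = a at *
    generalize σ 1 = b at *
    fin_cases a <;> fin_cases b <;> simp_all
  · rintro (⟨h0, h1⟩ | ⟨h0, h1⟩)
    · refine Quotient.sound (s := configSetoid X 2) ⟨1, ?_⟩
      funext i
      fin_cases i <;> simpa
    · refine Quotient.sound (s := configSetoid X 2) ⟨Equiv.swap 0 1, ?_⟩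
      funext i
      fin_cases i <;> simpa

end Projection

/-! ### The homotopy -/

/-- Ordered pairs of distinct points of the circle. -/
abbrev OffDiag : Type := {p : Circle × Circle // p.1 ≠ p.2}

/-- The pair `({α, β}, {α, γ})` with `α * β * γ = 1`, moved for time `t` towards the equator. -/
def trackFun (q : (Circle × Circle) × unitInterval) : Fin 2 → SymSq :=
  ![retract (q.1.1 * q.1.2)⁻¹ q.1.1 q.2, retract (q.1.1 * q.1.2)⁻¹ q.1.2 q.2]

lemma continuous_trackFun : Continuous trackFun := by
  refine continuous_pi fun i => ?_
  fin_cases i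
  · exact continuous_retract.comp
      (f := fun q : (Circle × Circle) × unitInterval => ((q.1.1 * q.1.2)⁻¹, q.1.1, q.2))
      (by fun_prop)
  · exact continuous_retract.comp
      (f := fun q : (Circle × Circle) × unitInterval => ((q.1.1 * q.1.2)⁻¹, q.1.2, q.2))
      (by fun_prop)

lemma symFun_trackFun_zero (q : (Circle × Circle) × unitInterval) :
    (symFun (trackFun q 0)).2 = ((q.1.2⁻¹ : Circle) : ℂ) := by
  simp only [trackFun, Matrix.cons_val_zero, symFun_retract, ← Circle.coe_mul]
  rw [mul_inv_rev, inv_mul_cancel_right]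

lemma symFun_trackFun_one (q : (Circle × Circle) × unitInterval) :
    (symFun (trackFun q 1)).2 = ((q.1.1⁻¹ : Circle) : ℂ) := by
  simp only [trackFun, Matrix.cons_val_one, Matrix.cons_val_zero, symFun_retract,
    ← Circle.coe_mul]
  rw [mul_inv, inv_mul_cancel_right]

lemma injective_trackFun_iff (q : (Circle × Circle) × unitInterval) :
    Function.Injective (trackFun q) ↔ q.1.1 ≠ q.1.2 := by
  constructor
  · intro h he
    refine absurd (@h 0 1 ?_) (by decide)
    simp [trackFun, he]
  · intro h
    have hne : trackFun q 0 ≠ trackFun q 1 := by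
      intro he
      have := congrArg (fun c => (symFun c).2) he
      simp only [symFun_trackFun_zero, symFun_trackFun_one] at this
      exact h (inv_injective (Circle.ext this)).symm
    intro i j hij
    fin_cases i <;> fin_cases j <;> simp_all [hne.symm]

/-- `trackFun` as a map to injective tuples. -/
def trackTuple (q : OffDiag × unitInterval) : InjTuple SymSq 2 :=
  ⟨trackFun (q.1.1, q.2), (injective_trackFun_iff _).2 q.1.2⟩

lemma isProperMap_trackTuple : IsProperMap trackTuple := by
  have h := continuous_trackFun.isProperMap.restrictPreimage
    {f : Fin 2 → SymSq | Function.Injective f}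
  let e : OffDiag × unitInterval ≃ₜ trackFun ⁻¹' {f | Function.Injective f} :=
    { toFun := fun q => ⟨(q.1.1, q.2), (trackTuple q).2⟩
      invFun := fun q => (⟨q.1.1, (injective_trackFun_iff q.1).1 q.2⟩, q.1.2)
      left_inv := fun _ => rfl
      right_inv := fun _ => rfl
      continuous_toFun := by fun_prop
      continuous_invFun := by fun_prop }
  have he : trackTuple =
      Set.restrictPreimage {f : Fin 2 → SymSq | Function.Injective f} trackFun ∘ e :=
    funext fun q => Subtype.ext rfl
  rw [he]
  exact h.comp e.isProperMap

/-- The configuration `{{α, β}, {α, γ}}` moved for time `t` towards the equator. -/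
def track (q : OffDiag × unitInterval) : Config SymSq 2 :=
  Quotient.mk (configSetoid SymSq 2) (trackTuple q)

lemma isProperMap_track : IsProperMap track :=
  isProperMap_configMk.comp isProperMap_trackTuple

lemma isProperMap_track_at (t : unitInterval) : IsProperMap fun p : OffDiag => track (p, t) :=
  isProperMap_track.comp
    (isProperMap_of_comp_of_t2 (by fun_prop : Continuous fun p : OffDiag => (p, t))
      continuous_fst isProperMap_id)

/-- Up to order, the pair `(β, γ)` can be read off from its track at any time, and it determines
the whole track. -/
lemma track_eq_of_track_eq {p p' : OffDiag} {t : unitInterval} (s : unitInterval)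
    (h : track (p, t) = track (p', t)) : track (p, s) = track (p', s) := by
  obtain ⟨⟨b, c⟩, hp⟩ := p
  obtain ⟨⟨b', c'⟩, hp'⟩ := p'
  have hprod {i j : Fin 2} (h : (trackTuple (⟨(b, c), hp⟩, t)).1 i =
      (trackTuple (⟨(b', c'), hp'⟩, t)).1 j) :
      (symFun (trackFun ((b, c), t) i)).2 = (symFun (trackFun ((b', c'), t) j)).2 := by
    exact congrArg (fun x => (symFun x).2) h
  rcases (configMk_two_eq_iff _ _).1 h with ⟨h0, h1⟩ | ⟨h0, h1⟩ <;>
    replace h0 := hprod h0 <;> replace h1 := hprod h1 <;>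
    simp only [symFun_trackFun_zero, symFun_trackFun_one, Circle.coe_inj, inv_inj] at h0 h1 <;>
    subst h0 h1
  · rfl
  · refine (configMk_two_eq_iff _ _).2 (Or.inr ?_)
    simp [trackTuple, trackFun, mul_comm]

lemma range_track_zero : Set.range (fun p : OffDiag => track (p, 0)) = DeltaSet := by
  ext d
  constructor
  · rintro ⟨p, rfl⟩
    refine ⟨(p.1.1 * p.1.2)⁻¹, p.1.1, p.1.2, p.2, by simp [mul_assoc], trackTuple (p, 0), rfl, ?_⟩
    simp [trackTuple, trackFun, retract_zero]
  · rintro ⟨α, β, γ, hne, hprod, f, rfl, h0, h1⟩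
    obtain rfl : α = (β * γ)⁻¹ := eq_inv_of_mul_eq_one_left (by rwa [← mul_assoc])
    refine ⟨⟨(β, γ), hne⟩, (configMk_two_eq_iff _ _).2 (Or.inl ?_)⟩
    simp [trackTuple, trackFun, retract_zero, h0, h1]

lemma range_track_one : Set.range (fun p : OffDiag => track (p, 1)) = BE2 := by
  ext d
  constructor
  · rintro ⟨p, rfl⟩
    refine ⟨trackTuple (p, 1), rfl, fun i => ?_⟩
    fin_cases i <;> exact retract_one_mem_equator _ _
  · rintro ⟨f, rfl, hf⟩
    have hcoord (i : Fin 2) : ∃ b : Circle, symFun (f.1 i) = (0, ((b⁻¹ : Circle) : ℂ)) := by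
      obtain ⟨x, y, hxy⟩ := mkSym_surjective (f.1 i)
      refine ⟨(x * y)⁻¹, Prod.ext ((mem_equator_iff _).1 (hf i)) ?_⟩
      rw [hxy, inv_inv, Circle.coe_mul, symFun_mkSym]
    obtain ⟨γ, hγ⟩ := hcoord 0
    obtain ⟨β, hβ⟩ := hcoord 1
    have hne : β ≠ γ := by
      rintro rfl
      exact absurd (f.2 (symFun_injective (hγ.trans hβ.symm))) (by decide)
    refine ⟨⟨(β, γ), hne⟩, (configMk_two_eq_iff _ _).2 (Or.inl ⟨?_, ?_⟩)⟩
    · refine symFun_injective (Prod.ext ?_ ?_)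
      · rw [hγ]; simp [trackTuple, trackFun]
      · rw [hγ]; exact symFun_trackFun_zero ((β, γ), 1)
    · refine symFun_injective (Prod.ext ?_ ?_)
      · rw [hβ]; simp [trackTuple, trackFun]
      · rw [hβ]; exact symFun_trackFun_one ((β, γ), 1)

/-- The parametrization of `Δ` by pairs of distinct points of the circle. -/
def deltaParam (p : OffDiag) : DeltaSet :=
  ⟨track (p, 0), range_track_zero ▸ Set.mem_range_self p⟩

lemma surjective_deltaParam : Function.Surjective deltaParam := by
  rintro ⟨d, hd⟩
  obtain ⟨p, rfl⟩ := range_track_zero.symm ▸ hd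
  exact ⟨p, rfl⟩

lemma isProperMap_deltaParam : IsProperMap deltaParam :=
  isProperMap_of_comp_of_inj ((isProperMap_track_at 0).continuous.subtype_mk _)
    continuous_subtype_val (isProperMap_track_at 0) Subtype.val_injective

/-- The homotopy moving `Δ` to `B(E,2)`. -/
def deltaHomotopy (q : DeltaSet × unitInterval) : Config SymSq 2 :=
  track ((surjective_deltaParam q.1).choose, q.2)

lemma deltaHomotopy_deltaParam (p : OffDiag) (t : unitInterval) :
    deltaHomotopy (deltaParam p, t) = track (p, t) :=
  track_eq_of_track_eq (t := 0) t
    (congrArg Subtype.val (surjective_deltaParam (deltaParam p)).choose_spec)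

lemma deltaHomotopy_comp :
    deltaHomotopy ∘ Prod.map deltaParam id = track :=
  funext fun q => deltaHomotopy_deltaParam q.1 q.2

lemma isProperMap_deltaHomotopy : IsProperMap deltaHomotopy := by
  have hproper : IsProperMap (Prod.map deltaParam (id : unitInterval → unitInterval)) :=
    isProperMap_deltaParam.prodMap isProperMap_id
  have hsurj : Function.Surjective (Prod.map deltaParam (id : unitInterval → unitInterval)) :=
    surjective_deltaParam.prodMap Function.surjective_id
  have hcont : Continuous deltaHomotopy := by
    rw [(hproper.isClosedMap.isQuotientMap hproper.continuous hsurj).continuous_iff,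
      deltaHomotopy_comp]
    exact isProperMap_track.continuous
  exact isProperMap_of_comp_of_surj hproper.continuous hcont
    (deltaHomotopy_comp ▸ isProperMap_track) hsurj

lemma isClosedEmbedding_deltaHomotopy_one :
    IsClosedEmbedding fun d : DeltaSet => deltaHomotopy (d, 1) := by
  have hcont : Continuous fun d : DeltaSet => deltaHomotopy (d, 1) :=
    isProperMap_deltaHomotopy.continuous.comp (by fun_prop)
  have hcomp : (fun d : DeltaSet => deltaHomotopy (d, 1)) ∘ deltaParam =
      fun p => track (p, 1) := funext fun p => deltaHomotopy_deltaParam p 1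
  refine .of_continuous_injective_isClosedMap hcont ?_
    (isProperMap_of_comp_of_surj isProperMap_deltaParam.continuous hcont
      (hcomp ▸ isProperMap_track_at 1) surjective_deltaParam).isClosedMap
  intro d d' h
  obtain ⟨p, rfl⟩ := surjective_deltaParam d
  obtain ⟨p', rfl⟩ := surjective_deltaParam d'
  simp only [deltaHomotopy_deltaParam] at h
  exact Subtype.ext (track_eq_of_track_eq 0 h)

lemma range_deltaHomotopy_one :
    Set.range (fun d : DeltaSet => deltaHomotopy (d, 1)) = BE2 := by
  rw [← range_track_one, ← surjective_deltaParam.range_comp]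
  exact congrArg Set.range (funext fun p => deltaHomotopy_deltaParam p 1)

/-- The subspaces `Δ` and `B(E,2)` of `B(Ψ,2)` are
homeomorphic; moreover there are a homeomorphism `h : Δ → B(E,2)` and a proper
continuous map `F : Δ × [0,1] → B(Ψ,2)` (proper: the preimage of every compact
set is compact) with `F(·,0)` the inclusion `Δ ↪ B(Ψ,2)` and `F(·,1)` the
composition of `h` with the inclusion `B(E,2) ↪ B(Ψ,2)`. -/
theorem delta_homeo_properly_homotopic_to_inclusion :
    ∃ (h : ↥DeltaSet ≃ₜ ↥BE2) (F : ↥DeltaSet × ↥unitInterval → Config SymSq 2),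
      Continuous F ∧
      (∀ K : Set (Config SymSq 2), IsCompact K → IsCompact (F ⁻¹' K)) ∧
      (∀ d : ↥DeltaSet, F (d, 0) = (d : Config SymSq 2)) ∧
      (∀ d : ↥DeltaSet, F (d, 1) = ((h d : ↥BE2) : Config SymSq 2)) := by
  refine ⟨isClosedEmbedding_deltaHomotopy_one.isEmbedding.toHomeomorph.trans
      (Homeomorph.setCongr range_deltaHomotopy_one), deltaHomotopy,
    isProperMap_deltaHomotopy.continuous,
    fun K hK => isProperMap_deltaHomotopy.isCompact_preimage hK,
    fun d => ?_, fun d => rfl⟩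
  obtain ⟨p, rfl⟩ := surjective_deltaParam d
  exact deltaHomotopy_deltaParam p 0

end
end
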